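/- Let (X_n)_{n≥1} be stationary and ergodic with X_1 ~ P, and suppose 0 < D = D_min(P,Q) < ∞, R(P,Q,D) < ∞, and ρ_Q(X_1) is not almost surely constant. Then: (i) Prob{ L_n(X_1^n, Q^n, D) = ∞ infinitely often } > 0; (ii) Prob{ L_n(X_1^n, Q^n, D) < ∞ infinitely often } = 1; and (iii) along the almost surely infinite random subsequence (N_m)_{m≥1} of indices n for which L_n(X_1^n, Q^n, D) is finite, lim_{m→∞} L_{N_m}(X_1^{N_m}, Q^{N_m}, D) = R(P,Q,D) almost surely. Moreover, (N_m)_{m≥1} coincides almost surely with the subsequence of indices n for which (1/n) Σ_{k=1}^n ρ_Q(X_k) ≤ D. -/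

import Mathlib

open MeasureTheory Filter Set Topology Classical
open scoped ENNReal NNReal

noncomputable section

/-- `-log t` as a value in `ℝ≥0∞` (equal to `∞` when `t = 0`); intended for `t ≤ 1`. -/
def negLog (t : ℝ≥0∞) : ℝ≥0∞ :=
  if t = 0 then ∞ else ENNReal.ofReal (-Real.log t.toReal)

/-- `log t` as a value in `ℝ≥0∞` (equal to `∞` when `t = ∞`); intended for `t ≥ 1`. -/
def posLog (t : ℝ≥0∞) : ℝ≥0∞ :=
  if t = ∞ then ∞ else ENNReal.ofReal (Real.log t.toReal)

/-- The extended-real-valued logarithm of an `ℝ≥0∞` number. -/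
def eLog (t : ℝ≥0∞) : EReal :=
  if t = 0 then ⊥ else if t = ∞ then ⊤ else ((Real.log t.toReal : ℝ) : EReal)

/-- Relative entropy `H(μ‖ν)` (in nats), valued in `ℝ≥0∞`: it equals
`∫ log (dμ/dν) dμ` when `μ ≪ ν` (and `+∞` when this integral is not defined,
which for probability measures can only mean `+∞`), and `+∞` when `¬ μ ≪ ν`. -/
def relEnt {α : Type*} [MeasurableSpace α] (μ ν : Measure α) : ℝ≥0∞ :=
  if μ ≪ ν ∧ Integrable (llr μ ν) μ then ENNReal.ofReal (∫ x, llr μ ν x ∂μ) else ∞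

/-- The set `W(P,D)` of couplings: probability measures on `S × T` with first
marginal `P` and expected distortion at most `D`. -/
def distSet {S T : Type*} [MeasurableSpace S] [MeasurableSpace T]
    (ρ : S × T → ℝ) (P : Measure S) (D : ℝ) : Set (Measure (S × T)) :=
  {W | IsProbabilityMeasure W ∧ W.map Prod.fst = P ∧
    ((∫⁻ z, ENNReal.ofReal (ρ z) ∂W : ℝ≥0∞) : EReal) ≤ ((D : ℝ) : EReal)}

/-- The rate function `R(P,Q,D) = inf_{W ∈ W(P,D)} H(W‖P×Q)` (equal to `+∞`
when `W(P,D)` is empty). -/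
def Rrate {S T : Type*} [MeasurableSpace S] [MeasurableSpace T]
    (ρ : S × T → ℝ) (P : Measure S) (Q : Measure T) (D : ℝ) : ℝ≥0∞ :=
  ⨅ W ∈ distSet ρ P D, relEnt W (P.prod Q)

/-- `Λ(P,Q,λ) = E_X[log E_Y e^{λρ(X,Y)}]`, valued in `EReal`.
For `λ ≥ 0` the integrand lies in `[0,∞]`; for `λ < 0` it lies in `[-∞,0]`. -/
def Lam {S T : Type*} [MeasurableSpace S] [MeasurableSpace T]
    (ρ : S × T → ℝ) (P : Measure S) (Q : Measure T) (l : ℝ) : EReal :=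
  if 0 ≤ l then
    ((∫⁻ x, posLog (∫⁻ y, ENNReal.ofReal (Real.exp (l * ρ (x, y))) ∂Q) ∂P : ℝ≥0∞) : EReal)
  else
    -(((∫⁻ x, negLog (∫⁻ y, ENNReal.ofReal (Real.exp (l * ρ (x, y))) ∂Q) ∂P : ℝ≥0∞) : EReal))

/-- The Fenchel–Legendre transform `Λ*(P,Q,D) = sup_{λ ≤ 0} [λD - Λ(P,Q,λ)]`. -/
def LamStar {S T : Type*} [MeasurableSpace S] [MeasurableSpace T]
    (ρ : S × T → ℝ) (P : Measure S) (Q : Measure T) (D : ℝ) : EReal :=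
  ⨆ l ∈ Iic (0 : ℝ), (((l * D : ℝ) : EReal) - Lam ρ P Q l)

/-- `ρ_Q(x) := essinf_{Y ∼ Q} ρ(x,Y)`. -/
def rhoQ {S T : Type*} [MeasurableSpace T]
    (ρ : S × T → ℝ) (Q : Measure T) (x : S) : ℝ :=
  essInf (fun y => ρ (x, y)) Q

/-- `D_min(P,Q) := inf {D : Λ*(P,Q,D) < ∞}`. -/
def DminPQ {S T : Type*} [MeasurableSpace S] [MeasurableSpace T]
    (ρ : S × T → ℝ) (P : Measure S) (Q : Measure T) : ℝ :=
  sInf {D : ℝ | LamStar ρ P Q D ≠ ⊤}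

/-- `D_ave(P,Q) := E ρ(X,Y)` for independent `X ∼ P`, `Y ∼ Q`, valued in `ℝ≥0∞`. -/
def DavePQ {S T : Type*} [MeasurableSpace S] [MeasurableSpace T]
    (ρ : S × T → ℝ) (P : Measure S) (Q : Measure T) : ℝ≥0∞ :=
  ∫⁻ z, ENNReal.ofReal (ρ z) ∂(P.prod Q)

/-- The candidate derivative `Λ'(λ)` of `Λ(P,Q,·)`. -/
def LamD {S T : Type*} [MeasurableSpace S] [MeasurableSpace T]
    (ρ : S × T → ℝ) (P : Measure S) (Q : Measure T) (l : ℝ) : ℝ :=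
  ∫ x, (∫ y, ρ (x, y) * Real.exp (l * ρ (x, y)) ∂Q) /
    (∫ y, Real.exp (l * ρ (x, y)) ∂Q) ∂P

/-- The left shift on sequences. -/
def shiftSeq {α : Type*} (x : ℕ → α) (n : ℕ) : α := x (n + 1)

/-- The single-letter distortion measure `ρ_n` on `n`-strings. -/
def rhoFin {S T : Type*} (ρ : S × T → ℝ) (n : ℕ) (x : Fin n → S) (y : Fin n → T) : ℝ :=
  (n : ℝ)⁻¹ * ∑ k, ρ (x k, y k)

/-- `L_n(x_1^n, Q^n, D) = -(1/n) log Q^n(B_n(x_1^n,D))`, valued in `ℝ≥0∞`,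
for a memoryless (product) codebook distribution `Q^n`. -/
def LnIID {S T : Type*} [MeasurableSpace T]
    (ρ : S × T → ℝ) (Q : Measure T) (D : ℝ) (n : ℕ) (x : ℕ → S) : ℝ≥0∞ :=
  (n : ℝ≥0∞)⁻¹ *
    negLog ((Measure.pi fun _ : Fin n => Q) {y | rhoFin ρ n (fun k => x k) y ≤ D})

/-- The empirical distribution `P_{x_1^n} = (1/n) ∑_{k=1}^n δ_{x_k}`. -/
def empMeas {S : Type*} [MeasurableSpace S] (n : ℕ) (x : ℕ → S) : Measure S :=
  (n : ℝ≥0∞)⁻¹ • ∑ k ∈ Finset.range n, Measure.dirac (x k)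

/-- The `n`-dimensional marginal of a measure on sequences. -/
def margN {α : Type*} [MeasurableSpace α] (μ : Measure (ℕ → α)) (n : ℕ) :
    Measure (Fin n → α) :=
  μ.map fun x (k : Fin n) => x (k : ℕ)

/-- The strong mixing condition `C⁻¹ 𝒬(A) 𝒬(B) ≤ 𝒬(A ∩ B) ≤ C 𝒬(A) 𝒬(B)` for all
`A ∈ σ(Y_1^n)`, `B ∈ σ(Y_{n+1}^∞)` and all `n`. -/
def Mixing {T : Type*} [MeasurableSpace T] (𝒬 : Measure (ℕ → T)) (C : ℝ) : Prop :=
  ∀ (n : ℕ) (A B : Set (ℕ → T)),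
    MeasurableSet[MeasurableSpace.comap (fun y (k : Fin n) => y (k : ℕ)) inferInstance] A →
    MeasurableSet[MeasurableSpace.comap (fun y (k : ℕ) => y (k + n)) inferInstance] B →
    (ENNReal.ofReal C)⁻¹ * (𝒬 A * 𝒬 B) ≤ 𝒬 (A ∩ B) ∧
      𝒬 (A ∩ B) ≤ ENNReal.ofReal C * (𝒬 A * 𝒬 B)

/-- `L_n(x_1^n, Q_n, D) = -(1/n) log Q_n(B_n(x_1^n,D))` where `Q_n` is the
`n`-dimensional marginal of the codebook process law `𝒬`. -/
def LnMem {S T : Type*} [MeasurableSpace T]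
    (ρ : S × T → ℝ) (𝒬 : Measure (ℕ → T)) (D : ℝ) (n : ℕ) (x : ℕ → S) : ℝ≥0∞ :=
  (n : ℝ≥0∞)⁻¹ * negLog (margN 𝒬 n {y | rhoFin ρ n (fun k => x k) y ≤ D})

/-- The set `W_n(P_n,D)` of couplings on `S^n × T^n`. -/
def distSetN {S T : Type*} [MeasurableSpace S] [MeasurableSpace T]
    (ρ : S × T → ℝ) (n : ℕ) (Pn : Measure (Fin n → S)) (D : ℝ) :
    Set (Measure ((Fin n → S) × (Fin n → T))) :=
  {W | IsProbabilityMeasure W ∧ W.map Prod.fst = Pn ∧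
    ((∫⁻ z, ENNReal.ofReal (rhoFin ρ n z.1 z.2) ∂W : ℝ≥0∞) : EReal) ≤ ((D : ℝ) : EReal)}

/-- `R_n(P_n,Q_n,D) = (1/n) inf_{W_n ∈ W_n(P_n,D)} H(W_n‖P_n×Q_n)`. -/
def RnMem {S T : Type*} [MeasurableSpace S] [MeasurableSpace T]
    (ρ : S × T → ℝ) (n : ℕ) (Pn : Measure (Fin n → S)) (Qn : Measure (Fin n → T))
    (D : ℝ) : ℝ≥0∞ :=
  (n : ℝ≥0∞)⁻¹ * ⨅ W ∈ distSetN ρ n Pn D, relEnt W (Pn.prod Qn)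

/-- `Λ_n(P_n,Q_n,λ) = E_{X_1^n}[log E_{Y_1^n} e^{λ ρ_n(X_1^n,Y_1^n)}]`. -/
def LamN {S T : Type*} [MeasurableSpace S] [MeasurableSpace T]
    (ρ : S × T → ℝ) (n : ℕ) (Pn : Measure (Fin n → S)) (Qn : Measure (Fin n → T))
    (l : ℝ) : EReal :=
  Lam (fun z => rhoFin ρ n z.1 z.2) Pn Qn l

/-- `Λ_n*(P_n,Q_n,D) = (1/n) sup_{λ ≤ 0} [λD - Λ_n(P_n,Q_n,λ)]`. -/
def LamStarN {S T : Type*} [MeasurableSpace S] [MeasurableSpace T]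
    (ρ : S × T → ℝ) (n : ℕ) (Pn : Measure (Fin n → S)) (Qn : Measure (Fin n → T))
    (D : ℝ) : EReal :=
  (((n : ℝ)⁻¹ : ℝ) : EReal) *
    ⨆ l ∈ Iic (0 : ℝ), (((l * D : ℝ) : EReal) - LamN ρ n Pn Qn l)

/-- One-sided Fenchel–Legendre transform `D ↦ sup_{λ ≤ 0} [λD - Λ(λ)]` of a
function `Λ : ℝ → EReal`. -/
def FLT (L : ℝ → EReal) (D : ℝ) : EReal :=
  ⨆ l ∈ Iic (0 : ℝ), (((l * D : ℝ) : EReal) - L l)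


section ErgodicPart

/-- Running minima of Birkhoff sums. -/
def runMin {Ω : Type*} (T : Ω → Ω) (f : Ω → ℝ) : ℕ → Ω → ℝ
  | 0 => f
  | (N + 1) => fun x => f x + min 0 (runMin T f N (T x))

variable {Ω : Type*} {T : Ω → Ω} {f : Ω → ℝ}

lemma runMin_succ_le (N : ℕ) (x : Ω) : runMin T f (N + 1) x ≤ runMin T f N x := by
  induction N generalizing x with
  | zero => simp [runMin]
  | succ N ih =>
    show f x + min 0 (runMin T f (N + 1) (T x)) ≤ f x + min 0 (runMin T f N (T x))
    have := ih (T x)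
    gcongr

lemma runMin_antitone (x : Ω) : Antitone (fun N => runMin T f N x) :=
  antitone_nat_of_succ_le fun N => runMin_succ_le N x

lemma runMin_le_sum (N n : ℕ) (hn : n ≤ N) (x : Ω) :
    runMin T f N x ≤ birkhoffSum T f (n + 1) x := by
  induction N generalizing x n with
  | zero => obtain rfl : n = 0 := by omega
            simp [runMin]
  | succ N ih =>
    rw [birkhoffSum_succ']
    show f x + min 0 (runMin T f N (T x)) ≤ _
    rcases n with _ | n
    · simp
    · have := ih n (by omega) (T x)
      have h2 := min_le_right 0 (runMin T f N (T x))
      linarith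

lemma runMin_ge (C : ℝ) (N : ℕ) (x : Ω) (h : ∀ n, C ≤ birkhoffSum T f (n + 1) x) :
    C ≤ runMin T f N x := by
  induction N generalizing x C with
  | zero => simpa [runMin] using h 0
  | succ N ih =>
    show C ≤ f x + min 0 (runMin T f N (T x))
    have h0 : C ≤ f x := by simpa using h 0
    have : C - f x ≤ runMin T f N (T x) := by
      apply ih
      intro n
      have := h (n + 1)
      rw [birkhoffSum_succ'] at this
      linarith
    have : C - f x ≤ min 0 (runMin T f N (T x)) := le_min (by linarith) this
    linarith

/-- The set where the running minima are bounded below. -/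
def bddSet (T : Ω → Ω) (f : Ω → ℝ) : Set Ω := {x | ∃ C : ℕ, ∀ N, -(C : ℝ) ≤ runMin T f N x}

lemma mem_bddSet_of {x : Ω} (C : ℝ) (h : ∀ N, C ≤ runMin T f N x) : x ∈ bddSet T f := by
  obtain ⟨k, hk⟩ := exists_nat_ge (-C)
  exact ⟨k, fun N => by linarith [h N]⟩

lemma bddSet_inv : T ⁻¹' (bddSet T f) = bddSet T f := by
  ext x
  constructor
  · rintro ⟨C, hC⟩
    apply mem_bddSet_of (f x - C)
    intro N
    rcases N with _ | N
    · simp [runMin]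
    · show _ ≤ f x + min 0 (runMin T f N (T x))
      have : -(C : ℝ) ≤ min 0 (runMin T f N (T x)) := le_min (by simp) (hC N)
      linarith
  · rintro ⟨C, hC⟩
    apply mem_bddSet_of (-C - f x)
    intro N
    have : -(C : ℝ) ≤ f x + min 0 (runMin T f N (T x)) := hC (N + 1)
    linarith [min_le_right 0 (runMin T f N (T x))]

variable [MeasurableSpace Ω] {μ : Measure Ω}

lemma runMin_measurable (hT : Measurable T) (hf : Measurable f) (N : ℕ) :
    Measurable (runMin T f N) := by
  induction N with
  | zero => exact hf
  | succ N ih => exact hf.add (measurable_const.min (ih.comp hT))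

lemma bddSet_measurable (hT : Measurable T) (hf : Measurable f) :
    MeasurableSet (bddSet T f) := by
  have : bddSet T f = ⋃ C : ℕ, ⋂ N, {x | -(C : ℝ) ≤ runMin T f N x} := by
    ext x; simp [bddSet]
  rw [this]
  exact MeasurableSet.iUnion fun C => MeasurableSet.iInter fun N =>
    measurableSet_le measurable_const (runMin_measurable hT hf N)

lemma runMin_integrable (hT : MeasurePreserving T μ μ) [IsProbabilityMeasure μ]
    (hf : Integrable f μ) (N : ℕ) : Integrable (runMin T f N) μ := by
  induction N with
  | zero => exact hf
  | succ N ih =>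
    exact hf.add ((integrable_zero _ _ _).inf (hT.integrable_comp_of_integrable ih))

lemma ae_bddSet [IsProbabilityMeasure μ] (hT : Ergodic T μ) (hfm : Measurable f)
    (hf : Integrable f μ) (hpos : 0 < ∫ x, f x ∂μ) : ∀ᵐ x ∂μ, x ∈ bddSet T f := by
  rcases hT.toPreErgodic.ae_mem_or_ae_notMem (bddSet_measurable hT.measurable hfm) bddSet_inv
    with h | h
  · exact h
  exfalso
  have hi := runMin_integrable hT.toMeasurePreserving hf
  have key : ∀ N, ∫ x, f x ∂μ ≤ ∫ x, max 0 (runMin T f N x) ∂μ := by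
    intro N
    have e1 : ∫ x, runMin T f (N + 1) x ∂μ
        = ∫ x, f x ∂μ + ∫ x, min 0 (runMin T f N x) ∂μ := by
      have hmin : Integrable (fun x => min 0 (runMin T f N x)) μ :=
        (integrable_zero _ _ _).inf (hi N)
      have hc : Integrable (fun x => min 0 (runMin T f N (T x))) μ :=
        hT.toMeasurePreserving.integrable_comp_of_integrable hmin
      have : ∫ x, min 0 (runMin T f N (T x)) ∂μ = ∫ x, min 0 (runMin T f N x) ∂μ := by
        conv_rhs => rw [← hT.toMeasurePreserving.map_eq]
        rw [integral_map hT.measurable.aemeasurable]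
        rw [hT.toMeasurePreserving.map_eq]
        exact hmin.aestronglyMeasurable
      rw [← this, ← integral_add hf hc]
      rfl
    have e2 : ∫ x, runMin T f (N + 1) x ∂μ ≤ ∫ x, runMin T f N x ∂μ :=
      integral_mono (hi _) (hi _) (fun x => runMin_succ_le N x)
    have e3 : ∫ x, runMin T f N x ∂μ
        = ∫ x, max 0 (runMin T f N x) ∂μ + ∫ x, min 0 (runMin T f N x) ∂μ := by
      have hmax : Integrable (fun x => max 0 (runMin T f N x)) μ :=
        (integrable_zero _ _ _).sup (hi N)
      have hmin : Integrable (fun x => min 0 (runMin T f N x)) μ :=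
        (integrable_zero _ _ _).inf (hi N)
      rw [← integral_add hmax hmin]
      apply integral_congr_ae
      filter_upwards with x
      rcases le_total 0 (runMin T f N x) with h | h <;> simp [h]
    linarith
  have lim : Tendsto (fun N => ∫ x, max 0 (runMin T f N x) ∂μ) atTop (𝓝 (∫ x, (0 : ℝ) ∂μ)) := by
    apply tendsto_integral_of_dominated_convergence (fun x => |f x|)
    · intro N
      exact ((integrable_zero _ _ _).sup (hi N)).aestronglyMeasurable
    · exact hf.abs
    · intro N
      filter_upwards with x
      rw [Real.norm_eq_abs, abs_of_nonneg (le_max_left _ _)]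
      apply max_le (abs_nonneg _)
      exact (runMin_antitone x (Nat.zero_le N)).trans (le_abs_self _)
    · filter_upwards [h] with x hx
      have : ∃ N, runMin T f N x < 0 := by
        by_contra hcon
        push Not at hcon
        exact hx (mem_bddSet_of 0 hcon)
      obtain ⟨N, hN⟩ := this
      apply tendsto_const_nhds.congr'
      filter_upwards [eventually_ge_atTop N] with n hn
      have : runMin T f n x ≤ runMin T f N x := runMin_antitone x hn
      rw [max_eq_left (by linarith)]
  simp only [integral_zero] at lim
  have := ge_of_tendsto' lim key
  linarith

/-- Sum of a shifted function. -/
lemma birkhoffSum_sub_const (c : ℝ) (n : ℕ) (x : Ω) :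
    birkhoffSum T (fun x => f x - c) n x = birkhoffSum T f n x - n * c := by
  simp [birkhoffSum, Finset.sum_sub_distrib]

lemma birkhoff_lower [IsProbabilityMeasure μ] (hT : Ergodic T μ) (hfm : Measurable f)
    (hf : Integrable f μ) : ∀ᵐ x ∂μ, ∀ c < ∫ x, f x ∂μ,
      ∀ᶠ n : ℕ in atTop, c < (n : ℝ)⁻¹ * birkhoffSum T f n x := by
  have h1 : ∀ᵐ x ∂μ, ∀ c : ℚ, (c : ℝ) < ∫ x, f x ∂μ → x ∈ bddSet T (fun x => f x - c) := by
    rw [ae_all_iff]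
    intro c
    by_cases hc : (c : ℝ) < ∫ x, f x ∂μ
    · have := ae_bddSet (f := fun x => f x - c) hT (hfm.sub_const _) (hf.sub (integrable_const _))
        (by rw [integral_sub hf (integrable_const _)]; simpa using hc)
      filter_upwards [this] with x hx _ using hx
    · filter_upwards with x h using absurd h hc
  filter_upwards [h1] with x hx c hc
  obtain ⟨c', hc1, hc2⟩ := exists_rat_btwn hc
  obtain ⟨C, hC⟩ := hx c' hc2
  have h2 : ∀ n : ℕ, 0 < n → (c' : ℝ) - (n : ℝ)⁻¹ * C ≤ (n : ℝ)⁻¹ * birkhoffSum T f n x := by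
    intro n hn
    obtain ⟨k, rfl⟩ : ∃ k, n = k + 1 := ⟨n - 1, by omega⟩
    have := (hC k).trans (runMin_le_sum k k le_rfl x)
    rw [birkhoffSum_sub_const] at this
    have hp : (0 : ℝ) < ((k + 1 : ℕ) : ℝ) := by positivity
    have h3 := mul_le_mul_of_nonneg_left this (inv_nonneg.2 hp.le)
    rw [mul_sub, inv_mul_cancel_left₀ hp.ne'] at h3
    linarith
  have h3 : Tendsto (fun n : ℕ => (c' : ℝ) - (n : ℝ)⁻¹ * C) atTop (𝓝 (c' - 0 * C)) :=
    tendsto_const_nhds.sub (tendsto_inv_atTop_nhds_zero_nat.mul_const _)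
  have h4 := h3.eventually (lt_mem_nhds (a := c) (by simpa using hc1))
  filter_upwards [h4, eventually_gt_atTop 0] with n hn hn0
  exact hn.trans_le (h2 n hn0)

/-- Birkhoff's pointwise ergodic theorem for ergodic maps. -/
lemma birkhoff_ergodic [IsProbabilityMeasure μ] (hT : Ergodic T μ) (hfm : Measurable f)
    (hf : Integrable f μ) : ∀ᵐ x ∂μ,
      Tendsto (fun n : ℕ => (n : ℝ)⁻¹ * birkhoffSum T f n x) atTop (𝓝 (∫ x, f x ∂μ)) := by
  filter_upwards [birkhoff_lower hT hfm hf, birkhoff_lower (f := fun x => - f x) hT hfm.neg hf.neg]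
    with x h1 h2
  rw [tendsto_order]
  refine ⟨h1, fun c hc => ?_⟩
  have := h2 (-c) (by rw [integral_neg]; linarith)
  filter_upwards [this] with n hn
  have e : birkhoffSum T (fun x => - f x) n x = - birkhoffSum T f n x := by
    simp [birkhoffSum]
  rw [e] at hn
  linarith

lemma ae_iterate (hT : MeasurePreserving T μ μ) {p : Ω → Prop} (h : ∀ᵐ x ∂μ, p x) :
    ∀ᵐ x ∂μ, ∀ n, p (T^[n] x) := by
  rw [ae_all_iff]
  intro n
  exact (hT.iterate n).quasiMeasurePreserving.ae h

lemma coboundary [IsProbabilityMeasure μ] (hT : Ergodic T μ) (hfm : Measurable f)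
    (hf : Integrable f μ) (h0 : ∫ x, f x ∂μ = 0) (hb : ∀ᵐ x ∂μ, x ∈ bddSet T f) :
    ∃ m : Ω → ℝ, Measurable m ∧ ∀ᵐ x ∂μ, m x ≤ 0 ∧
      (∀ n, birkhoffSum T f n x = m x - m (T^[n] x)) ∧
      (∀ C, (∀ n, C ≤ birkhoffSum T f (n + 1) x) → C ≤ m x) := by
  let m : Ω → ℝ := fun x => ⨅ N, runMin T f N x
  have hm : Measurable m := Measurable.iInf fun N => runMin_measurable hT.measurable hfm N
  have hlim : ∀ᵐ x ∂μ, Tendsto (fun N => runMin T f N x) atTop (𝓝 (m x)) := by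
    filter_upwards [hb] with x ⟨C, hC⟩
    exact tendsto_atTop_ciInf (runMin_antitone x) ⟨-C, by rintro _ ⟨N, rfl⟩; exact hC N⟩
  have hlim' := ae_iterate hT.toMeasurePreserving hlim
  have hrec : ∀ᵐ x ∂μ, m x = f x + min 0 (m (T x)) := by
    filter_upwards [hlim'] with x hx
    have h1 : Tendsto (fun N => runMin T f (N + 1) x) atTop (𝓝 (m x)) :=
      (hx 0).comp (tendsto_add_atTop_nat 1)
    have h2 : Tendsto (fun N => f x + min 0 (runMin T f N (T x))) atTop
        (𝓝 (f x + min 0 (m (T x)))) :=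
      tendsto_const_nhds.add (tendsto_const_nhds.min (hx 1))
    exact tendsto_nhds_unique h1 h2
  have hle : ∀ᵐ x ∂μ, m x ≤ f x := by
    filter_upwards [hrec] with x hx
    linarith [min_le_left 0 (m (T x))]
  let b : Ω → ℝ := fun x => max 0 (m x)
  have hbm : Measurable b := measurable_const.max hm
  have hbi : Integrable b μ := by
    apply hf.abs.mono' hbm.aestronglyMeasurable
    filter_upwards [hle] with x hx
    rw [Real.norm_eq_abs, abs_of_nonneg (le_max_left _ _)]
    exact max_le (abs_nonneg _) (hx.trans (le_abs_self _))
  have hbint : ∫ x, b x ∂μ ≤ 0 := by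
    have h1 := birkhoff_ergodic hT hfm hf
    have h2 := birkhoff_ergodic hT hbm hbi
    have : ∀ᵐ x ∂μ, ∫ x, b x ∂μ ≤ 0 := by
      filter_upwards [h1, h2, ae_iterate hT.toMeasurePreserving hrec] with x h1 h2 h3
      have hs : ∀ n, birkhoffSum T f n x
          = birkhoffSum T b n x + min 0 (m x) - min 0 (m (T^[n] x)) := by
        intro n
        induction n with
        | zero => simp
        | succ n ih =>
          rw [birkhoffSum_succ, birkhoffSum_succ, ih]
          have h4 := h3 n
          rw [← Function.iterate_succ_apply' T] at h4
          have : m (T^[n] x) = b (T^[n] x) + min 0 (m (T^[n] x)) := by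
            rcases le_total 0 (m (T^[n] x)) with h | h <;> simp [b, h]
          linarith
      have h5 : Tendsto (fun n : ℕ => (n : ℝ)⁻¹ * birkhoffSum T f n x - (n : ℝ)⁻¹ * min 0 (m x))
          atTop (𝓝 (∫ x, f x ∂μ - 0 * min 0 (m x))) :=
        h1.sub (tendsto_inv_atTop_nhds_zero_nat.mul_const _)
      rw [h0] at h5
      simp only [zero_mul, sub_zero] at h5
      apply le_of_tendsto_of_tendsto' h2 h5
      intro n
      rw [← mul_sub]
      apply mul_le_mul_of_nonneg_left _ (by positivity)
      rw [hs n]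
      linarith [min_le_left 0 (m (T^[n] x))]
    exact this.exists.choose_spec
  have hm0 : ∀ᵐ x ∂μ, m x ≤ 0 := by
    have hb0 : 0 ≤ b := fun x => le_max_left _ _
    have : b =ᵐ[μ] 0 := (integral_eq_zero_iff_of_nonneg hb0 hbi).1
      (le_antisymm hbint (integral_nonneg hb0))
    filter_upwards [this] with x hx
    exact (le_max_right 0 (m x)).trans hx.le
  refine ⟨m, hm, ?_⟩
  filter_upwards [ae_iterate hT.toMeasurePreserving hm0, ae_iterate hT.toMeasurePreserving hrec,
    hlim] with x h1 h2 h3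
  refine ⟨h1 0, ?_, ?_⟩
  · intro n
    induction n with
    | zero => simp
    | succ n ih =>
      rw [birkhoffSum_succ, ih]
      have h4 := h2 n
      rw [← Function.iterate_succ_apply' T, min_eq_right (h1 (n + 1))] at h4
      linarith
  · intro C hC
    exact ge_of_tendsto' h3 fun N => runMin_ge C N x hC

lemma mem_bddSet_of_sum {x : Ω} (C : ℝ) (h : ∀ n, C ≤ birkhoffSum T f (n + 1) x) :
    x ∈ bddSet T f := mem_bddSet_of C fun N => runMin_ge C N x h

lemma mem_bddSet_of_eventually {x : Ω} (C : ℝ) (h : ∀ᶠ n in atTop, C ≤ birkhoffSum T f n x) :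
    x ∈ bddSet T f := by
  obtain ⟨N, hN⟩ := eventually_atTop.1 h
  apply mem_bddSet_of_sum (-(∑ k ∈ Finset.range (N + 1), |birkhoffSum T f k x|) - |C|)
  intro n
  have hs : 0 ≤ ∑ k ∈ Finset.range (N + 1), |birkhoffSum T f k x| :=
    Finset.sum_nonneg fun _ _ => abs_nonneg _
  by_cases hn : n + 1 < N + 1
  · have := Finset.single_le_sum (f := fun k => |birkhoffSum T f k x|)
      (fun _ _ => abs_nonneg _) (Finset.mem_range.2 hn)
    have h2 := neg_abs_le (birkhoffSum T f (n + 1) x)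
    have := abs_nonneg C
    linarith
  · have := hN (n + 1) (by omega)
    linarith [neg_abs_le C]

lemma birkhoffSum_measurable (hT : Measurable T) (hf : Measurable f) (n : ℕ) :
    Measurable (birkhoffSum T f n) := by
  unfold birkhoffSum
  exact Finset.measurable_sum _ fun k _ => hf.comp (hT.iterate k)

/-- Sums of a centered function are nonpositive infinitely often. -/
lemma frequently_nonpos [IsProbabilityMeasure μ] (hT : Ergodic T μ) (hfm : Measurable f)
    (hf : Integrable f μ) (h0 : ∫ x, f x ∂μ = 0) :
    ∀ᵐ x ∂μ, ∃ᶠ n in atTop, birkhoffSum T f n x ≤ 0 := by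
  let A : Set Ω := {x | ∀ n, 0 < birkhoffSum T f (n + 1) x}
  have hAm : MeasurableSet A := by
    have : A = ⋂ n, {x | 0 < birkhoffSum T f (n + 1) x} := by ext; simp [A]
    rw [this]
    exact MeasurableSet.iInter fun n =>
      measurableSet_lt measurable_const (birkhoffSum_measurable hT.measurable hfm _)
  have hA : ∀ᵐ x ∂μ, x ∉ A := by
    rcases hT.toPreErgodic.ae_mem_or_ae_notMem (bddSet_measurable hT.measurable hfm)
      (bddSet_inv (f := f)) with h | h
    · obtain ⟨m, -, hm⟩ := coboundary hT hfm hf h0 h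
      have hrec := hT.toMeasurePreserving.conservative.ae_mem_imp_frequently_image_mem
        hAm.nullMeasurableSet
      have hm' := ae_iterate hT.toMeasurePreserving hm
      filter_upwards [hm', hrec] with x h1 h2 hxA
      obtain ⟨n, hn, hnA⟩ := (h2 hxA).forall_exists_of_atTop 1
      have hz : ∀ k, T^[k] x ∈ A → m (T^[k] x) = 0 := fun k hk =>
        le_antisymm (h1 k).1 ((h1 k).2.2 0 fun j => (hk j).le)
      have e := (h1 0).2.1 n
      have z0 := hz 0 hxA
      simp only [Function.iterate_zero, id] at e z0
      rw [z0, hz n hnA] at e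
      have := hxA (n - 1)
      rw [Nat.sub_add_cancel hn] at this
      linarith
    · filter_upwards [h] with x hx hxA
      exact hx (mem_bddSet_of_sum 0 fun n => (hxA n).le)
  filter_upwards [ae_iterate hT.toMeasurePreserving hA] with x hx
  by_contra hcon
  rw [not_frequently] at hcon
  obtain ⟨N, hN⟩ := eventually_atTop.1 hcon
  push Not at hN
  let n0 := Nat.findGreatest (fun n => birkhoffSum T f n x ≤ 0) N
  have hn0 : birkhoffSum T f n0 x ≤ 0 :=
    Nat.findGreatest_spec (P := fun n => birkhoffSum T f n x ≤ 0) (Nat.zero_le N) (by simp)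
  apply hx n0
  intro n
  have e := birkhoffSum_add T f n0 (n + 1) x
  have : 0 < birkhoffSum T f (n0 + (n + 1)) x := by
    by_cases hle : n0 + (n + 1) ≤ N
    · have := Nat.findGreatest_is_greatest (P := fun n => birkhoffSum T f n x ≤ 0)
        (n := N) (k := n0 + (n + 1)) (by omega) hle
      exact not_le.1 this
    · exact hN _ (by omega)
  linarith

/-- A centered function whose sums are eventually nonnegative almost surely vanishes. -/
lemma ae_zero_of_eventually_nonneg [IsProbabilityMeasure μ] (hT : Ergodic T μ)
    (hfm : Measurable f) (hf : Integrable f μ) (h0 : ∫ x, f x ∂μ = 0)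
    (hev : ∀ᵐ x ∂μ, ∀ᶠ n in atTop, 0 ≤ birkhoffSum T f n x) : ∀ᵐ x ∂μ, f x = 0 := by
  obtain ⟨m, hmm, hm⟩ := coboundary hT hfm hf h0
    (hev.mono fun x hx => mem_bddSet_of_eventually 0 hx)
  -- if `m` exceeds a rational level with positive probability then it does so a.e.
  have key : ∀ c : ℚ, (∀ᵐ x ∂μ, m x ≤ c) ∨ (∀ᵐ x ∂μ, (c : ℝ) < m x) := by
    intro c
    by_cases hc : ∀ᵐ x ∂μ, m x ≤ c
    · exact Or.inl hc
    right
    let B : Set Ω := {x | (c : ℝ) < m x}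
    have hBm : MeasurableSet B := measurableSet_lt measurable_const hmm
    let F : Set Ω := {x | ∃ᶠ n in atTop, T^[n] x ∈ B}
    have hFm : MeasurableSet F := by
      have : F = limsup (fun n => T^[n] ⁻¹' B) atTop := by
        ext x; simp [F, mem_limsup_iff_frequently_mem]
      rw [this]
      exact MeasurableSet.measurableSet_limsup fun n => (hT.measurable.iterate n) hBm
    have hFinv : T ⁻¹' F = F := by
      ext x
      show (∃ᶠ n in atTop, T^[n] (T x) ∈ B) ↔ (∃ᶠ n in atTop, T^[n] x ∈ B)
      have : (∃ᶠ n in atTop, T^[n] x ∈ B) ↔ (∃ᶠ n in atTop, T^[n + 1] x ∈ B) := by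
        conv_lhs => rw [← map_add_atTop_eq_nat 1]
        rw [frequently_map]
      rw [this]
      simp [Function.iterate_succ_apply]
    have hrec := hT.toMeasurePreserving.conservative.ae_mem_imp_frequently_image_mem
        hBm.nullMeasurableSet
    rcases hT.toPreErgodic.ae_mem_or_ae_notMem hFm hFinv with h | h
    · filter_upwards [h, hev, hm] with x h1 h2 h3
      obtain ⟨n, hn1, hn2⟩ := (h1.and_eventually h2).exists
      rw [h3.2.1 n] at hn2
      have : (c : ℝ) < m (T^[n] x) := hn1
      linarith
    · exfalso
      apply hc
      filter_upwards [hrec, h] with x h1 h2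
      by_contra h3
      exact h2 (h1 (not_le.1 h3))
  have hconst : ∀ᵐ x ∂μ, m (T x) = m x := by
    have h1 : ∀ᵐ x ∂μ, ∀ c : ℚ, m x ≤ c ↔ m (T x) ≤ c := by
      rw [ae_all_iff]
      intro c
      rcases key c with h | h
      · filter_upwards [ae_iterate hT.toMeasurePreserving h] with x hx
        exact ⟨fun _ => hx 1, fun _ => hx 0⟩
      · filter_upwards [ae_iterate hT.toMeasurePreserving h] with x hx
        exact ⟨fun h => absurd h (not_le.2 (hx 0)), fun h => absurd h (not_le.2 (hx 1))⟩
    filter_upwards [h1] with x hx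
    rcases lt_trichotomy (m (T x)) (m x) with h | h | h
    · obtain ⟨c, hc1, hc2⟩ := exists_rat_btwn h
      exact absurd ((hx c).2 hc1.le) (not_le.2 hc2)
    · exact h
    · obtain ⟨c, hc1, hc2⟩ := exists_rat_btwn h
      exact absurd ((hx c).1 hc1.le) (not_le.2 hc2)
  filter_upwards [hconst, hm] with x h1 h2
  have := h2.2.1 1
  simp only [birkhoffSum_one, Function.iterate_one] at this
  rw [this, h1, sub_self]

end ErgodicPart

section InfoPart

variable {S T : Type*} [MeasurableSpace S] [MeasurableSpace T]

lemma rhoQ_cobdd {ρ : S × T → ℝ} (Q : Measure T) [IsProbabilityMeasure Q] (x : S) :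
    ∃ b : ℝ, ∀ a : ℝ, (∀ᵐ y ∂Q, a ≤ ρ (x, y)) → a ≤ b := by
  by_contra hcon
  push Not at hcon
  have : ∀ᵐ y ∂Q, ∀ n : ℕ, (n : ℝ) ≤ ρ (x, y) := by
    rw [ae_all_iff]
    intro n
    obtain ⟨a, ha, hna⟩ := hcon n
    filter_upwards [ha] with y hy using hna.le.trans hy
  obtain ⟨y, hy⟩ := this.exists
  obtain ⟨n, hn⟩ := exists_nat_gt (ρ (x, y))
  linarith [hy n]

lemma rhoQ_le_ae {ρ : S × T → ℝ} (hρ0 : ∀ z, 0 ≤ ρ z) (Q : Measure T) [IsProbabilityMeasure Q]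
    (x : S) : ∀ᵐ y ∂Q, rhoQ ρ Q x ≤ ρ (x, y) := by
  apply ae_essInf_le
  exact ⟨0, by simp [hρ0]⟩

lemma le_rhoQ_iff {ρ : S × T → ℝ} (hρ0 : ∀ z, 0 ≤ ρ z) (Q : Measure T) [IsProbabilityMeasure Q]
    (x : S) (a : ℝ) : a ≤ rhoQ ρ Q x ↔ ∀ᵐ y ∂Q, a ≤ ρ (x, y) := by
  constructor
  · intro h
    filter_upwards [rhoQ_le_ae hρ0 Q x] with y hy using h.trans hy
  · intro h
    obtain ⟨b, hb⟩ := rhoQ_cobdd (ρ := ρ) Q x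
    have hco : IsCoboundedUnder (fun x1 x2 => x1 ≥ x2) (ae Q) fun y => ρ (x, y) :=
      ⟨b, fun a ha => hb a (by simpa using ha)⟩
    exact le_essInf_of_ae_le a h hco

lemma rhoQ_nonneg {ρ : S × T → ℝ} (hρ0 : ∀ z, 0 ≤ ρ z) (Q : Measure T) [IsProbabilityMeasure Q]
    (x : S) : 0 ≤ rhoQ ρ Q x :=
  (le_rhoQ_iff hρ0 Q x 0).2 (ae_of_all _ fun _ => hρ0 _)

lemma measurable_rhoQ {ρ : S × T → ℝ} (hρm : Measurable ρ) (hρ0 : ∀ z, 0 ≤ ρ z) (Q : Measure T)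
    [IsProbabilityMeasure Q] : Measurable (rhoQ ρ Q) := by
  apply measurable_of_Ici
  intro a
  have hm : MeasurableSet {z : S × T | ρ z < a} := measurableSet_lt hρm measurable_const
  have : rhoQ ρ Q ⁻¹' Ici a = (fun x => Q (Prod.mk x ⁻¹' {z : S × T | ρ z < a})) ⁻¹' {0} := by
    ext x
    simp only [mem_preimage, mem_Ici, mem_singleton_iff, le_rhoQ_iff hρ0]
    rw [ae_iff]
    simp only [not_le]
    rfl
  rw [this]
  exact measurable_measure_prodMk_left hm (measurableSet_singleton 0)

/-- The glueing construction: on `G` use `Q` conditioned to the sections of `A`, off `G` use `W0`. -/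
lemma glue {P : Measure S} {Q : Measure T} [IsProbabilityMeasure P] [IsProbabilityMeasure Q]
    (W0 : Measure (S × T)) [IsProbabilityMeasure W0] (hW0 : W0.map Prod.fst = P)
    (hac : W0 ≪ P.prod Q) (hllrInt : Integrable (llr W0 (P.prod Q)) W0)
    {A : Set (S × T)} (hA : MeasurableSet A) {G : Set S} (hG : MeasurableSet G)
    (hGpos : ∀ x ∈ G, Q (Prod.mk x ⁻¹' A) ≠ 0)
    (hlog : IntegrableOn (fun x => Real.log (Q (Prod.mk x ⁻¹' A)).toReal) G P) :
    ∃ W : Measure (S × T), IsProbabilityMeasure W ∧ W.map Prod.fst = P ∧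
      relEnt W (P.prod Q) = ENNReal.ofReal
        ((∫ x in G, -Real.log (Q (Prod.mk x ⁻¹' A)).toReal ∂P)
          + ∫ z in Prod.fst ⁻¹' Gᶜ, llr W0 (P.prod Q) z ∂W0) ∧
      ∀ (g : S × T → ℝ≥0∞) (h : S → ℝ≥0∞), Measurable h → (∀ z ∈ A, g z ≤ h z.1) →
        ∫⁻ z, g z ∂W ≤ ∫⁻ x in G, h x ∂P + ∫⁻ z in Prod.fst ⁻¹' Gᶜ, g z ∂W0 := by
  set q : S → ℝ≥0∞ := fun x => Q (Prod.mk x ⁻¹' A) with hq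
  have hqm : Measurable q := measurable_measure_prodMk_left hA
  have hqtop : ∀ x, q x ≠ ∞ := fun x => measure_ne_top _ _
  set φ := W0.rnDeriv (P.prod Q) with hφ
  have hφm : Measurable φ := Measure.measurable_rnDeriv _ _
  have hGs : MeasurableSet (Prod.fst ⁻¹' G : Set (S × T)) := measurable_fst hG
  have hGc : (Prod.fst ⁻¹' Gᶜ : Set (S × T)) = (Prod.fst ⁻¹' G)ᶜ := rfl
  let ψ : S × T → ℝ≥0∞ := (Prod.fst ⁻¹' G).piecewise
    (A.indicator fun z => (q z.1)⁻¹) φ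
  have hψ1m : Measurable (A.indicator fun z : S × T => (q z.1)⁻¹) :=
    ((hqm.comp measurable_fst).inv).indicator hA
  have hψm : Measurable ψ := Measurable.piecewise hGs hψ1m hφm
  let W := (P.prod Q).withDensity ψ
  -- behaviour off `G`
  have K2 : W.restrict (Prod.fst ⁻¹' Gᶜ) = W0.restrict (Prod.fst ⁻¹' Gᶜ) := by
    conv_rhs => rw [← Measure.withDensity_rnDeriv_eq W0 (P.prod Q) hac]
    rw [hGc, restrict_withDensity hGs.compl, restrict_withDensity hGs.compl]
    apply withDensity_congr_ae
    filter_upwards [ae_restrict_mem hGs.compl] with z hz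
    exact Set.piecewise_eq_of_notMem _ _ _ hz
  have K1 : (W.restrict (Prod.fst ⁻¹' G)).map Prod.fst = P.restrict G := by
    ext B hB
    rw [Measure.map_apply measurable_fst hB, Measure.restrict_apply (measurable_fst hB),
      Measure.restrict_apply hB, ← preimage_inter]
    have hBG := hB.inter hG
    rw [withDensity_apply _ (measurable_fst hBG)]
    have : ∫⁻ z in Prod.fst ⁻¹' (B ∩ G), ψ z ∂(P.prod Q)
        = ∫⁻ z, (B ∩ G).indicator (fun x => (q x)⁻¹) z.1 * A.indicator 1 z ∂(P.prod Q) := by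
      rw [← lintegral_indicator (measurable_fst hBG)]
      congr 1
      ext z
      by_cases h1 : z.1 ∈ B ∩ G
      · have h2 : z ∈ Prod.fst ⁻¹' (B ∩ G) := h1
        rw [indicator_of_mem h2, indicator_of_mem h1,
          show ψ z = A.indicator (fun z => (q z.1)⁻¹) z from
            Set.piecewise_eq_of_mem _ _ _ (show z ∈ Prod.fst ⁻¹' G from h1.2)]
        by_cases h3 : z ∈ A <;> simp [h3]
      · have h2 : z ∉ Prod.fst ⁻¹' (B ∩ G) := h1
        rw [indicator_of_notMem h2, indicator_of_notMem h1, zero_mul]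
    rw [this, lintegral_prod]
    · have : ∀ x, ∫⁻ y, (B ∩ G).indicator (fun x => (q x)⁻¹) x * A.indicator 1 (x, y) ∂Q
          = (B ∩ G).indicator 1 x := by
        intro x
        rw [lintegral_const_mul]
        · have : ∫⁻ y, A.indicator (1 : S × T → ℝ≥0∞) (x, y) ∂Q = q x := by
            rw [hq]
            simp only
            rw [← lintegral_indicator_one (measurable_prodMk_left hA)]
            rfl
          rw [this]
          by_cases h1 : x ∈ B ∩ G
          · rw [indicator_of_mem h1, indicator_of_mem h1,
              ENNReal.inv_mul_cancel (hGpos x h1.2) (hqtop x)]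
            rfl
          · rw [indicator_of_notMem h1, indicator_of_notMem h1, zero_mul]
        · exact (measurable_one.indicator hA).comp measurable_prodMk_left
      simp only [this]
      rw [lintegral_indicator_one hBG]
    · exact ((((hqm.inv).indicator hBG).comp measurable_fst).mul
        (measurable_one.indicator hA)).aemeasurable
  have K3 : ∀ᵐ z ∂(W.restrict (Prod.fst ⁻¹' G)), z ∈ A := by
    have e : W.restrict (Prod.fst ⁻¹' G) = ((P.prod Q).restrict (Prod.fst ⁻¹' G)).withDensity
        (A.indicator fun z => (q z.1)⁻¹) := by
      rw [restrict_withDensity hGs]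
      apply withDensity_congr_ae
      filter_upwards [ae_restrict_mem hGs] with z hz
      exact Set.piecewise_eq_of_mem _ _ _ hz
    rw [e, ae_withDensity_iff hψ1m]
    filter_upwards with z hz
    by_contra h
    exact hz (indicator_of_notMem h _)
  have hsum : W = W.restrict (Prod.fst ⁻¹' G) + W0.restrict (Prod.fst ⁻¹' Gᶜ) := by
    rw [← K2, hGc, Measure.restrict_add_restrict_compl hGs]
  have hmarg : W.map Prod.fst = P := by
    rw [hsum, Measure.map_add _ _ measurable_fst, K1]
    have : (W0.restrict (Prod.fst ⁻¹' Gᶜ)).map Prod.fst = P.restrict Gᶜ := by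
      rw [← hW0, Measure.restrict_map measurable_fst hG.compl]
    rw [this, Measure.restrict_add_restrict_compl hG]
  have hprob : IsProbabilityMeasure W := by
    constructor
    have := congrArg (fun m => m univ) hmarg
    simpa [Measure.map_apply measurable_fst MeasurableSet.univ] using this
  have hWac : W ≪ P.prod Q := withDensity_absolutelyContinuous _ _
  have hrn : W.rnDeriv (P.prod Q) =ᵐ[W] ψ :=
    hWac.ae_le (Measure.rnDeriv_withDensity (P.prod Q) hψm)
  have hllrG : ∀ᵐ z ∂(W.restrict (Prod.fst ⁻¹' G)),
      llr W (P.prod Q) z = -Real.log (q z.1).toReal := by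
    filter_upwards [ae_restrict_of_ae hrn, ae_restrict_mem hGs, K3] with z h1 h2 h3
    rw [llr_def]
    simp only
    rw [h1, show ψ z = A.indicator (fun z => (q z.1)⁻¹) z from
            Set.piecewise_eq_of_mem _ _ _ h2, indicator_of_mem h3, ENNReal.toReal_inv,
            Real.log_inv]
  have hllrGc : ∀ᵐ z ∂(W0.restrict (Prod.fst ⁻¹' Gᶜ)),
      llr W (P.prod Q) z = llr W0 (P.prod Q) z := by
    rw [← K2]
    filter_upwards [ae_restrict_of_ae hrn, ae_restrict_mem hGs.compl] with z h1 h2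
    rw [llr_def, llr_def]
    simp only
    rw [h1, show ψ z = φ z from Set.piecewise_eq_of_notMem _ _ _ h2]
  have hlogm : Measurable fun x => -Real.log (q x).toReal :=
    (Real.measurable_log.comp hqm.ennreal_toReal).neg
  have i1 : Integrable (llr W (P.prod Q)) (W.restrict (Prod.fst ⁻¹' G)) := by
    apply Integrable.congr _ (hllrG.mono fun z hz => hz.symm)
    have : Integrable (fun x => -Real.log (q x).toReal) (P.restrict G) := hlog.neg
    rw [← K1] at this
    exact this.comp_measurable measurable_fst
  have i2 : Integrable (llr W (P.prod Q)) (W0.restrict (Prod.fst ⁻¹' Gᶜ)) :=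
    (hllrInt.restrict).congr (hllrGc.mono fun z hz => hz.symm)
  have iW : Integrable (llr W (P.prod Q)) W := by
    have := i1.add_measure i2
    rwa [← hsum] at this
  refine ⟨W, hprob, hmarg, ?_, ?_⟩
  · unfold relEnt
    rw [if_pos ⟨hWac, iW⟩]
    congr 1
    rw [← integral_add_compl hGs iW, ← hGc, K2, integral_congr_ae hllrG,
      integral_congr_ae hllrGc]
    congr 1
    rw [← K1, integral_map measurable_fst.aemeasurable hlogm.aestronglyMeasurable]
  · intro g h hh hgh
    rw [hsum, lintegral_add_measure]
    gcongr
    rw [← K1, lintegral_map hh measurable_fst]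
    apply lintegral_mono_ae
    filter_upwards [K3] with z hz using hgh z hz

/-- Gibbs-type lower bound for a coupling concentrated on `A`. -/
lemma gibbs {P : Measure S} {Q : Measure T} [IsProbabilityMeasure P] [IsProbabilityMeasure Q]
    (W0 : Measure (S × T)) [IsProbabilityMeasure W0] (hW0 : W0.map Prod.fst = P)
    (hac : W0 ≪ P.prod Q) (hllrInt : Integrable (llr W0 (P.prod Q)) W0)
    {A : Set (S × T)} (hA : MeasurableSet A) (hWA : ∀ᵐ z ∂W0, z ∈ A) :
    (∀ᵐ x ∂P, Q (Prod.mk x ⁻¹' A) ≠ 0) ∧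
    Integrable (fun x => -Real.log (Q (Prod.mk x ⁻¹' A)).toReal) P ∧
    ∫ x, -Real.log (Q (Prod.mk x ⁻¹' A)).toReal ∂P ≤ ∫ z, llr W0 (P.prod Q) z ∂W0 := by
  set q : S → ℝ≥0∞ := fun x => Q (Prod.mk x ⁻¹' A) with hq
  have hqm : Measurable q := measurable_measure_prodMk_left hA
  have hqtop : ∀ x, q x ≠ ∞ := fun x => measure_ne_top _ _
  set φ := W0.rnDeriv (P.prod Q) with hφ
  have hφm : Measurable φ := Measure.measurable_rnDeriv _ _
  have hq0 : ∀ᵐ x ∂P, q x ≠ 0 := by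
    have hms : MeasurableSet {x | q x ≠ 0} := (hqm (measurableSet_singleton 0)).compl
    rw [← hW0, ae_map_iff measurable_fst.aemeasurable hms]
    have : ∀ᵐ z ∂(P.prod Q), ¬ (z ∈ A ∧ q z.1 = 0) := by
      have hms2 : MeasurableSet {z : S × T | ¬ (z ∈ A ∧ q z.1 = 0)} :=
        (hA.inter ((hqm.comp measurable_fst) (measurableSet_singleton 0))).compl
      rw [Measure.ae_prod_iff_ae_ae hms2]
      filter_upwards with x
      by_cases hx : q x = 0
      · have : ∀ᵐ y ∂Q, y ∉ Prod.mk x ⁻¹' A := measure_eq_zero_iff_ae_notMem.1 hx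
        filter_upwards [this] with y hy h using hy h.1
      · filter_upwards with y h using hx h.2
    filter_upwards [hac.ae_le this, hWA] with z h1 h2 h3 using h1 ⟨h2, h3⟩
  have hq0' : ∀ᵐ z ∂W0, q z.1 ≠ 0 := by
    rw [← hW0] at hq0
    exact ae_of_ae_map measurable_fst.aemeasurable hq0
  let e : S × T → ℝ≥0∞ := A.indicator fun z => (φ z * q z.1)⁻¹
  have hem : Measurable e := ((hφm.mul (hqm.comp measurable_fst)).inv).indicator hA
  have he : ∫⁻ z, e z ∂W0 ≤ 1 := by
    rw [← Measure.withDensity_rnDeriv_eq W0 (P.prod Q) hac,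
      lintegral_withDensity_eq_lintegral_mul _ hφm hem]
    calc ∫⁻ z, (φ * e) z ∂(P.prod Q) ≤ ∫⁻ z, (q z.1)⁻¹ * A.indicator 1 z ∂(P.prod Q) := by
          apply lintegral_mono_ae
          filter_upwards [Measure.rnDeriv_lt_top W0 (P.prod Q)] with z hz
          by_cases h : z ∈ A
          · simp only [Pi.mul_apply, e, indicator_of_mem h, Pi.one_apply, mul_one]
            by_cases h0 : φ z = 0
            · simp [h0]
            · rw [ENNReal.mul_inv (Or.inl h0) (Or.inl hz.ne), ← mul_assoc,
                ENNReal.mul_inv_cancel h0 hz.ne, one_mul]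
          · simp [e, h]
      _ = ∫⁻ x, (q x)⁻¹ * q x ∂P := by
          have hmm : Measurable fun z : S × T => (q z.1)⁻¹ * A.indicator 1 z :=
            (hqm.comp measurable_fst).inv.mul (measurable_one.indicator hA)
          rw [lintegral_prod _ hmm.aemeasurable]
          congr 1
          ext x
          have hm3 : Measurable fun y => A.indicator (1 : S × T → ℝ≥0∞) (x, y) :=
            (measurable_one.indicator hA).comp measurable_prodMk_left
          show ∫⁻ y, (q x)⁻¹ * A.indicator 1 (x, y) ∂Q = _
          rw [lintegral_const_mul _ hm3]
          congr 1
          rw [hq]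
          simp only
          rw [← lintegral_indicator_one (measurable_prodMk_left hA)]
          rfl
      _ ≤ ∫⁻ x, 1 ∂P := by
          apply lintegral_mono
          intro x
          show (q x)⁻¹ * q x ≤ 1
          rw [mul_comm]
          exact ENNReal.mul_inv_le_one _
      _ = 1 := by simp
  have hei : Integrable (fun z => (e z).toReal) W0 :=
    integrable_toReal_of_lintegral_ne_top hem.aemeasurable (he.trans_lt ENNReal.one_lt_top).ne
  have heint : ∫ z, (e z).toReal ∂W0 ≤ 1 := by
    rw [integral_toReal hem.aemeasurable
      (ae_lt_top hem (he.trans_lt ENNReal.one_lt_top).ne)]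
    exact ENNReal.toReal_le_of_le_ofReal zero_le_one (by simpa using he)
  have hpt : ∀ᵐ z ∂W0, -Real.log (q z.1).toReal
      ≤ llr W0 (P.prod Q) z - 1 + (e z).toReal := by
    filter_upwards [hWA, hq0', Measure.rnDeriv_pos hac, hac.ae_le (Measure.rnDeriv_lt_top W0 (P.prod Q))]
      with z h1 h2 h3 h4
    have a1 : 0 < (φ z).toReal := ENNReal.toReal_pos h3.ne' h4.ne
    have a2 : 0 < (q z.1).toReal := ENNReal.toReal_pos h2 (hqtop _)
    have := Real.one_sub_inv_le_log_of_pos (mul_pos a1 a2)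
    rw [Real.log_mul a1.ne' a2.ne'] at this
    have e1 : (e z).toReal = ((φ z).toReal * (q z.1).toReal)⁻¹ := by
      simp only [e, indicator_of_mem h1, ENNReal.toReal_inv, ENNReal.toReal_mul]
    rw [e1, llr_def]
    simp only
    linarith
  have hnn : ∀ x, 0 ≤ -Real.log (q x).toReal := by
    intro x
    have : (q x).toReal ≤ 1 := ENNReal.toReal_le_of_le_ofReal zero_le_one (by simpa using prob_le_one)
    linarith [Real.log_nonpos ENNReal.toReal_nonneg this]
  have hlogm : Measurable fun x => -Real.log (q x).toReal :=
    (Real.measurable_log.comp hqm.ennreal_toReal).neg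
  have hri : Integrable (fun z => llr W0 (P.prod Q) z - 1 + (e z).toReal) W0 :=
    (hllrInt.sub (integrable_const _)).add hei
  have hqi : Integrable (fun z : S × T => -Real.log (q z.1).toReal) W0 := by
    apply hri.mono' (hlogm.comp measurable_fst).aestronglyMeasurable
    filter_upwards [hpt] with z hz
    show |-Real.log (q z.1).toReal| ≤ _
    rw [abs_of_nonneg (hnn _)]
    exact hz
  refine ⟨hq0, ?_, ?_⟩
  · rw [← hW0, integrable_map_measure hlogm.aestronglyMeasurable measurable_fst.aemeasurable]
    exact hqi
  · have e0 : ∫ x, -Real.log (q x).toReal ∂P = ∫ z, -Real.log (q z.1).toReal ∂W0 := by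
      conv_lhs => rw [← hW0]
      rw [integral_map measurable_fst.aemeasurable hlogm.aestronglyMeasurable]
    rw [e0]
    refine (integral_mono_ae hqi hri hpt).trans ?_
    have hi1 : Integrable (fun z => llr W0 (P.prod Q) z - 1) W0 := hllrInt.sub (integrable_const _)
    rw [integral_add hi1 hei, integral_sub hllrInt (integrable_const _)]
    simp only [integral_const, probReal_univ, smul_eq_mul, mul_one]
    linarith

lemma coe_le_iff {a : ℝ≥0∞} {D : ℝ} (hD : 0 ≤ D) :
    ((a : EReal) ≤ ((D : ℝ) : EReal)) ↔ a ≤ ENNReal.ofReal D := by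
  rw [← EReal.coe_ennreal_le_coe_ennreal_iff, EReal.coe_ennreal_ofReal, max_eq_left hD]

lemma exists_of_Rrate {ρ : S × T → ℝ} {P : Measure S} {Q : Measure T} {D : ℝ}
    (h : Rrate ρ P Q D ≠ ⊤) : 0 ≤ D ∧ ∃ W : Measure (S × T), IsProbabilityMeasure W ∧
      W.map Prod.fst = P ∧ ∫⁻ z, ENNReal.ofReal (ρ z) ∂W ≤ ENNReal.ofReal D ∧
      W ≪ P.prod Q ∧ Integrable (llr W (P.prod Q)) W := by
  unfold Rrate at h
  have h' := lt_top_iff_ne_top.2 h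
  simp only [iInf_lt_iff] at h'
  obtain ⟨W, ⟨hp, hm, hd⟩, hW⟩ := h'
  have hD : 0 ≤ D := by
    have : ((0 : ℝ≥0∞) : EReal) ≤ ((D : ℝ) : EReal) :=
      le_trans (EReal.coe_ennreal_le_coe_ennreal_iff.2 bot_le) hd
    simpa using this
  refine ⟨hD, W, hp, hm, (coe_le_iff hD).1 hd, ?_⟩
  by_contra hcon
  unfold relEnt at hW
  rw [if_neg hcon] at hW
  exact lt_irrefl _ hW

lemma rhoQ_le_coupling {ρ : S × T → ℝ} (hρm : Measurable ρ) (hρ0 : ∀ z, 0 ≤ ρ z)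
    {P : Measure S} {Q : Measure T} [IsProbabilityMeasure P] [IsProbabilityMeasure Q]
    {W : Measure (S × T)} (hac : W ≪ P.prod Q) : ∀ᵐ z ∂W, rhoQ ρ Q z.1 ≤ ρ z := by
  have hms : MeasurableSet {z : S × T | rhoQ ρ Q z.1 ≤ ρ z} :=
    measurableSet_le ((measurable_rhoQ hρm hρ0 Q).comp measurable_fst) hρm
  have h : ∀ᵐ z ∂(P.prod Q), rhoQ ρ Q z.1 ≤ ρ z := by
    rw [Measure.ae_prod_iff_ae_ae hms]
    filter_upwards with x using rhoQ_le_ae hρ0 Q x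
  exact hac.ae_le h

lemma lintegral_rhoQ_ge {ρ : S × T → ℝ} (hρm : Measurable ρ) (hρ0 : ∀ z, 0 ≤ ρ z)
    {P : Measure S} {Q : Measure T} [IsProbabilityMeasure P] [IsProbabilityMeasure Q] {D : ℝ}
    (hDmin : D = sInf {D' : ℝ | Rrate ρ P Q D' ≠ ⊤}) (hRfin : Rrate ρ P Q D ≠ ⊤) :
    ENNReal.ofReal D ≤ ∫⁻ x, ENNReal.ofReal (rhoQ ρ Q x) ∂P := by
  obtain ⟨hD0, W0, hW0p, hW0m, hW0d, hac, hllrInt⟩ := exists_of_Rrate hRfin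
  have hrm := measurable_rhoQ hρm hρ0 Q
  by_contra hcon
  push Not at hcon
  set I := ∫⁻ x, ENNReal.ofReal (rhoQ ρ Q x) ∂P with hI
  have hItop : I ≠ ⊤ := (hcon.trans ENNReal.ofReal_lt_top).ne
  have hIlt : I.toReal < D := by
    rw [← ENNReal.ofReal_toReal hItop] at hcon
    exact (ENNReal.ofReal_lt_ofReal_iff_of_nonneg ENNReal.toReal_nonneg).1 hcon
  obtain ⟨ε, hε, hε2⟩ : ∃ ε : ℝ, 0 < ε ∧ I.toReal + 2 * ε < D :=
    ⟨(D - I.toReal) / 4, by linarith, by linarith⟩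
  let A : Set (S × T) := {z | ρ z ≤ rhoQ ρ Q z.1 + ε}
  have hA : MeasurableSet A := measurableSet_le hρm ((hrm.comp measurable_fst).add_const _)
  let q : S → ℝ≥0∞ := fun x => Q (Prod.mk x ⁻¹' A)
  have hqm : Measurable q := measurable_measure_prodMk_left hA
  have hq0 : ∀ x, q x ≠ 0 := by
    intro x h0
    have : ∀ᵐ y ∂Q, rhoQ ρ Q x + ε ≤ ρ (x, y) := by
      have : ∀ᵐ y ∂Q, y ∉ Prod.mk x ⁻¹' A := measure_eq_zero_iff_ae_notMem.1 h0
      filter_upwards [this] with y hy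
      exact (not_le.1 hy).le
    have := (le_rhoQ_iff hρ0 Q x _).2 this
    linarith
  let G : ℕ → Set S := fun n => {x | (n : ℝ≥0∞)⁻¹ ≤ q x}
  have hG : ∀ n, MeasurableSet (G n) := fun n => measurableSet_le measurable_const hqm
  have hGc_anti : Antitone fun n => (Prod.fst ⁻¹' (G n)ᶜ : Set (S × T)) := by
    intro n m hnm z hz hz2
    apply hz
    exact le_trans (ENNReal.inv_le_inv.2 (by exact_mod_cast hnm)) hz2
  have hGc_empty : ⋂ n, (Prod.fst ⁻¹' (G n)ᶜ : Set (S × T)) = ∅ := by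
    rw [eq_empty_iff_forall_notMem]
    intro z hz
    simp only [mem_iInter] at hz
    obtain ⟨n, hn⟩ := ENNReal.exists_inv_nat_lt (hq0 z.1)
    exact hz n hn.le
  have hlim : Tendsto (fun n => ∫⁻ z in Prod.fst ⁻¹' (G n)ᶜ, ENNReal.ofReal (ρ z) ∂W0)
      atTop (𝓝 0) := by
    apply tendsto_setLIntegral_zero
    · exact (hW0d.trans_lt ENNReal.ofReal_lt_top).ne
    · have := tendsto_measure_iInter_atTop (μ := W0)
        (fun n => (measurable_fst (hG n).compl).nullMeasurableSet) hGc_anti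
        ⟨0, measure_ne_top _ _⟩
      rw [hGc_empty, measure_empty] at this
      exact this
  obtain ⟨n, hn, hn0⟩ := ((hlim.eventually (gt_mem_nhds
    (ENNReal.ofReal_pos.2 hε))).and (eventually_gt_atTop 0)).exists
  have hlog : IntegrableOn (fun x => Real.log (q x).toReal) (G n) P := by
    apply Integrable.mono' (integrable_const (Real.log n))
    · exact (Real.measurable_log.comp hqm.ennreal_toReal).aestronglyMeasurable
    · filter_upwards [ae_restrict_mem (hG n)] with x hx
      have hx' : (n : ℝ≥0∞)⁻¹ ≤ q x := hx
      have h1 : ((n : ℝ))⁻¹ ≤ (q x).toReal := by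
        have := ENNReal.toReal_mono (measure_ne_top _ _) hx'
        simpa using this
      have h2 : (q x).toReal ≤ 1 :=
        ENNReal.toReal_le_of_le_ofReal zero_le_one (by simpa using prob_le_one)
      have hnp : (0 : ℝ) < (n : ℝ)⁻¹ := by positivity
      have h3 := Real.log_le_log hnp h1
      rw [Real.log_inv] at h3
      have h4 := Real.log_nonpos ENNReal.toReal_nonneg h2
      rw [Real.norm_eq_abs, abs_of_nonpos h4]
      linarith
  obtain ⟨W, hWp, hWm, hWr, hWd⟩ := glue W0 hW0m hac hllrInt hA (hG n) (fun x _ => hq0 x) hlog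
  have hd := hWd (fun z => ENNReal.ofReal (ρ z)) (fun x => ENNReal.ofReal (rhoQ ρ Q x + ε))
    (hrm.add_const _).ennreal_ofReal (fun z hz => ENNReal.ofReal_le_ofReal hz)
  have hd2 : ∫⁻ z, ENNReal.ofReal (ρ z) ∂W ≤ ENNReal.ofReal (I.toReal + 2 * ε) := by
    refine hd.trans ?_
    have h1 : ∫⁻ x in G n, ENNReal.ofReal (rhoQ ρ Q x + ε) ∂P ≤ I + ENNReal.ofReal ε := by
      refine (setLIntegral_le_lintegral _ _).trans ?_
      have : ∀ x, ENNReal.ofReal (rhoQ ρ Q x + ε)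
          = ENNReal.ofReal (rhoQ ρ Q x) + ENNReal.ofReal ε :=
        fun x => ENNReal.ofReal_add (rhoQ_nonneg hρ0 Q x) hε.le
      simp only [this]
      rw [lintegral_add_right _ measurable_const]
      simp [hI]
    refine (add_le_add h1 hn.le).trans ?_
    rw [show I.toReal + 2 * ε = I.toReal + ε + ε by ring,
      ENNReal.ofReal_add (by positivity) hε.le, ENNReal.ofReal_add (by positivity) hε.le,
      ENNReal.ofReal_toReal hItop]
  have hmem : I.toReal + 2 * ε ∈ {D' : ℝ | Rrate ρ P Q D' ≠ ⊤} := by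
    have : Rrate ρ P Q (I.toReal + 2 * ε) ≤ relEnt W (P.prod Q) :=
      iInf₂_le W ⟨hWp, hWm, (coe_le_iff (by positivity)).2 hd2⟩
    rw [hWr] at this
    exact (this.trans_lt ENNReal.ofReal_lt_top).ne
  have : D ≤ I.toReal + 2 * ε := by
    rw [hDmin]
    exact csInf_le ⟨0, fun D' hD' => (exists_of_Rrate hD').1⟩ hmem
  linarith

/-- The set where the distortion attains its essential infimum. -/
def optSet (ρ : S × T → ℝ) (Q : Measure T) : Set (S × T) := {z | ρ z = rhoQ ρ Q z.1}

/-- `-log Q(A_x)`. -/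
def optCost (ρ : S × T → ℝ) (Q : Measure T) (x : S) : ℝ :=
  -Real.log (Q (Prod.mk x ⁻¹' optSet ρ Q)).toReal

lemma info_main {ρ : S × T → ℝ} (hρm : Measurable ρ) (hρ0 : ∀ z, 0 ≤ ρ z)
    {P : Measure S} {Q : Measure T} [IsProbabilityMeasure P] [IsProbabilityMeasure Q] {D : ℝ}
    (hDmin : D = sInf {D' : ℝ | Rrate ρ P Q D' ≠ ⊤}) (hRfin : Rrate ρ P Q D ≠ ⊤) :
    Integrable (rhoQ ρ Q) P ∧ ∫ x, rhoQ ρ Q x ∂P = D ∧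
    (∀ᵐ x ∂P, Q (Prod.mk x ⁻¹' optSet ρ Q) ≠ 0) ∧
    Integrable (optCost ρ Q) P ∧ Rrate ρ P Q D = ENNReal.ofReal (∫ x, optCost ρ Q x ∂P) := by
  have hge := lintegral_rhoQ_ge hρm hρ0 hDmin hRfin
  have hrm := measurable_rhoQ hρm hρ0 Q
  have hA : MeasurableSet (optSet ρ Q) := measurableSet_eq_fun hρm (hrm.comp measurable_fst)
  have hcoup : ∀ W : Measure (S × T), IsProbabilityMeasure W → W.map Prod.fst = P →
      ∫⁻ z, ENNReal.ofReal (ρ z) ∂W ≤ ENNReal.ofReal D → W ≪ P.prod Q →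
      (∫⁻ x, ENNReal.ofReal (rhoQ ρ Q x) ∂P = ENNReal.ofReal D) ∧ ∀ᵐ z ∂W, z ∈ optSet ρ Q := by
    intro W hp hm hd hac
    have hle := rhoQ_le_coupling hρm hρ0 hac
    have e : ∫⁻ x, ENNReal.ofReal (rhoQ ρ Q x) ∂P = ∫⁻ z, ENNReal.ofReal (rhoQ ρ Q z.1) ∂W := by
      conv_lhs => rw [← hm]
      rw [lintegral_map hrm.ennreal_ofReal measurable_fst]
    have hle2 : ∫⁻ z, ENNReal.ofReal (rhoQ ρ Q z.1) ∂W ≤ ∫⁻ z, ENNReal.ofReal (ρ z) ∂W :=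
      lintegral_mono_ae (hle.mono fun z hz => ENNReal.ofReal_le_ofReal hz)
    have heq : ∫⁻ x, ENNReal.ofReal (rhoQ ρ Q x) ∂P = ENNReal.ofReal D :=
      le_antisymm (e.le.trans (hle2.trans hd)) hge
    refine ⟨heq, ?_⟩
    have := ae_eq_of_ae_le_of_lintegral_le
      (hle.mono fun z hz => ENNReal.ofReal_le_ofReal hz)
      (by rw [← e, heq]; exact ENNReal.ofReal_ne_top) hρm.ennreal_ofReal.aemeasurable
      (by rw [← e, heq]; exact hd)
    filter_upwards [this] with z hz
    exact ((ENNReal.ofReal_eq_ofReal_iff (rhoQ_nonneg hρ0 Q _) (hρ0 z)).1 hz).symm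
  obtain ⟨hD0, W0, hW0p, hW0m, hW0d, hac, hllrInt⟩ := exists_of_Rrate hRfin
  obtain ⟨heq, hWA⟩ := hcoup W0 hW0p hW0m hW0d hac
  obtain ⟨hq0, hqi, -⟩ := gibbs W0 hW0m hac hllrInt hA hWA
  have hri : Integrable (rhoQ ρ Q) P := by
    refine ⟨hrm.aestronglyMeasurable, ?_⟩
    rw [hasFiniteIntegral_iff_ofReal (ae_of_all _ (rhoQ_nonneg hρ0 Q)), heq]
    exact ENNReal.ofReal_lt_top
  have hrint : ∫ x, rhoQ ρ Q x ∂P = D := by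
    rw [integral_eq_lintegral_of_nonneg_ae (ae_of_all _ (rhoQ_nonneg hρ0 Q))
      hrm.aestronglyMeasurable, heq, ENNReal.toReal_ofReal hD0]
  refine ⟨hri, hrint, hq0, hqi, le_antisymm ?_ ?_⟩
  · let G : Set S := {x | Q (Prod.mk x ⁻¹' optSet ρ Q) ≠ 0}
    have hG : MeasurableSet G :=
      (measurable_measure_prodMk_left hA (measurableSet_singleton 0)).compl
    have hGc : P Gᶜ = 0 := hq0
    have hWGc : W0 (Prod.fst ⁻¹' Gᶜ) = 0 := by
      rw [← Measure.map_apply measurable_fst hG.compl, hW0m, hGc]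
    have hGr : P.restrict G = P := Measure.restrict_eq_self_of_ae_mem hq0
    have hlog : IntegrableOn (fun x => Real.log (Q (Prod.mk x ⁻¹' optSet ρ Q)).toReal) G P := by
      have := hqi.neg
      simp only [Pi.neg_def, neg_neg] at this
      exact this.integrableOn
    obtain ⟨W, hWp, hWm, hWr, hWd⟩ := glue W0 hW0m hac hllrInt hA hG (fun x hx => hx) hlog
    have hd := hWd (fun z => ENNReal.ofReal (ρ z)) (fun x => ENNReal.ofReal (rhoQ ρ Q x))
      hrm.ennreal_ofReal (fun z hz => (congrArg ENNReal.ofReal hz).le)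
    rw [Measure.restrict_eq_zero.2 hWGc, lintegral_zero_measure, add_zero, hGr, heq] at hd
    rw [Measure.restrict_eq_zero.2 hWGc, integral_zero_measure, add_zero, hGr] at hWr
    have : Rrate ρ P Q D ≤ relEnt W (P.prod Q) :=
      iInf₂_le W ⟨hWp, hWm, (coe_le_iff hD0).2 hd⟩
    rw [hWr] at this
    exact this
  · refine le_iInf₂ fun W hW => ?_
    obtain ⟨hp, hm, hd⟩ := hW
    unfold relEnt
    split_ifs with h
    · obtain ⟨-, hA'⟩ := hcoup W hp hm ((coe_le_iff hD0).1 hd) h.1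
      exact ENNReal.ofReal_le_ofReal (gibbs W hm h.1 h.2 hA hA').2.2
    · exact le_top


/-- The `Q^n`-mass of the distortion ball. -/
def ballMass (ρ : S × T → ℝ) (Q : Measure T) (D : ℝ) (n : ℕ) (x : ℕ → S) : ℝ≥0∞ :=
  (Measure.pi fun _ : Fin n => Q) {y | rhoFin ρ n (fun k => x k) y ≤ D}

lemma mem_ball_iff {ρ : S × T → ℝ} {D : ℝ} {n : ℕ} (hn : 0 < n) (x : ℕ → S) (y : Fin n → T) :
    rhoFin ρ n (fun k => x k) y ≤ D ↔ ∑ k : Fin n, ρ (x k, y k) ≤ n * D := by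
  unfold rhoFin
  have : (0 : ℝ) < n := by exact_mod_cast hn
  rw [inv_mul_le_iff₀ this]

lemma ballMass_le_one (ρ : S × T → ℝ) (Q : Measure T) [IsProbabilityMeasure Q] (D : ℝ) (n : ℕ)
    (x : ℕ → S) : ballMass ρ Q D n x ≤ 1 := prob_le_one

lemma LnIID_ne_top_iff {ρ : S × T → ℝ} {Q : Measure T} [IsProbabilityMeasure Q] {D : ℝ} {n : ℕ}
    (hn : 0 < n) (x : ℕ → S) : LnIID ρ Q D n x ≠ ⊤ ↔ ballMass ρ Q D n x ≠ 0 := by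
  have h : LnIID ρ Q D n x = (n : ℝ≥0∞)⁻¹ * negLog (ballMass ρ Q D n x) := rfl
  rw [h]
  unfold negLog
  split_ifs with h0
  · simp [h0, ENNReal.mul_top]
  · simp only [ne_eq, h0, not_false_eq_true, iff_true]
    exact ENNReal.mul_ne_top (by simp [hn.ne']) ENNReal.ofReal_ne_top

lemma LnIID_eq {ρ : S × T → ℝ} {Q : Measure T} [IsProbabilityMeasure Q] {D : ℝ} {n : ℕ}
    (hn : 0 < n) (x : ℕ → S) (h0 : ballMass ρ Q D n x ≠ 0) :
    LnIID ρ Q D n x = ENNReal.ofReal ((n : ℝ)⁻¹ * -Real.log (ballMass ρ Q D n x).toReal) := by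
  have h : LnIID ρ Q D n x = (n : ℝ≥0∞)⁻¹ * negLog (ballMass ρ Q D n x) := rfl
  rw [h]
  unfold negLog
  have : (0 : ℝ) < n := by exact_mod_cast hn
  rw [if_neg h0, ENNReal.ofReal_mul (by positivity), ENNReal.ofReal_inv_of_pos this,
    ENNReal.ofReal_natCast]

lemma LnIID_zero_ne_top {ρ : S × T → ℝ} {Q : Measure T} [IsProbabilityMeasure Q] {D : ℝ}
    (hD : 0 < D) (x : ℕ → S) : LnIID ρ Q D 0 x ≠ ⊤ := by
  unfold LnIID
  have : {y : Fin 0 → T | rhoFin ρ 0 (fun k => x k) y ≤ D} = univ := by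
    ext y
    simp [rhoFin, hD.le]
  rw [this]
  simp [negLog]

lemma sum_le_of_ballMass {ρ : S × T → ℝ} (hρ0 : ∀ z, 0 ≤ ρ z)
    {Q : Measure T} [IsProbabilityMeasure Q] {D : ℝ} {n : ℕ}
    (hn : 0 < n) (x : ℕ → S) (h0 : ballMass ρ Q D n x ≠ 0) :
    ∑ k ∈ Finset.range n, rhoQ ρ Q (x k) ≤ n * D := by
  have hae : ∀ᵐ y ∂(Measure.pi fun _ : Fin n => Q), ∀ k : Fin n, rhoQ ρ Q (x k) ≤ ρ (x k, y k) := by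
    rw [ae_all_iff]
    intro k
    exact (Measure.tendsto_eval_ae_ae (μ := fun _ : Fin n => Q) (i := k)).eventually
      (rhoQ_le_ae hρ0 Q (x k))
  have hfr : ∃ᵐ y ∂(Measure.pi fun _ : Fin n => Q), rhoFin ρ n (fun k => x k) y ≤ D :=
    frequently_ae_iff.2 h0
  obtain ⟨y, hy, hk⟩ := (hfr.and_eventually hae).exists
  rw [mem_ball_iff hn] at hy
  rw [Finset.sum_range (f := fun k => rhoQ ρ Q (x k))]
  exact (Finset.sum_le_sum fun k _ => hk k).trans hy

lemma prod_le_ballMass {ρ : S × T → ℝ} {Q : Measure T} [IsProbabilityMeasure Q] {D : ℝ} {n : ℕ}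
    (hn : 0 < n) (x : ℕ → S) (h : ∑ k ∈ Finset.range n, rhoQ ρ Q (x k) ≤ n * D) :
    ∏ k ∈ Finset.range n, Q (Prod.mk (x k) ⁻¹' optSet ρ Q) ≤ ballMass ρ Q D n x := by
  rw [Finset.prod_range (f := fun k => Q (Prod.mk (x k) ⁻¹' optSet ρ Q)),
    ← Measure.pi_pi (fun _ : Fin n => Q) (fun k : Fin n => Prod.mk (x k) ⁻¹' optSet ρ Q)]
  apply measure_mono
  intro y hy
  rw [mem_setOf_eq, mem_ball_iff hn]
  rw [Finset.sum_range (f := fun k => rhoQ ρ Q (x k))] at h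
  refine le_trans (Finset.sum_le_sum fun k _ => ?_) h
  exact (show ρ (x k, y k) = rhoQ ρ Q (x k) from hy k (mem_univ k)).le

/-- Normalised exponential moment. -/
def expMom (ρ : S × T → ℝ) (Q : Measure T) (l : ℝ) (x : S) : ℝ :=
  ∫ y, Real.exp (-(l * (ρ (x, y) - rhoQ ρ Q x))) ∂Q

lemma meas_sec {ρ : S × T → ℝ} (hρm : Measurable ρ) (Q : Measure T) (l : ℝ) (x : S) :
    Measurable fun y => Real.exp (-(l * (ρ (x, y) - rhoQ ρ Q x))) := by
  have : Measurable fun y => ρ (x, y) := hρm.comp measurable_prodMk_left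
  fun_prop

lemma exp_le_one_ae {ρ : S × T → ℝ} (hρ0 : ∀ z, 0 ≤ ρ z)
    (Q : Measure T) [IsProbabilityMeasure Q] {l : ℝ} (hl : 0 ≤ l) (x : S) :
    ∀ᵐ y ∂Q, ‖Real.exp (-(l * (ρ (x, y) - rhoQ ρ Q x)))‖ ≤ 1 := by
  filter_upwards [rhoQ_le_ae hρ0 Q x] with y hy
  rw [Real.norm_eq_abs, abs_of_pos (Real.exp_pos _), Real.exp_le_one_iff]
  nlinarith [mul_nonneg hl (sub_nonneg.2 hy)]

lemma integrable_sec {ρ : S × T → ℝ} (hρm : Measurable ρ) (hρ0 : ∀ z, 0 ≤ ρ z)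
    (Q : Measure T) [IsProbabilityMeasure Q] {l : ℝ} (hl : 0 ≤ l) (x : S) :
    Integrable (fun y => Real.exp (-(l * (ρ (x, y) - rhoQ ρ Q x)))) Q :=
  Integrable.mono' (integrable_const 1) (meas_sec hρm Q l x).aestronglyMeasurable
    (exp_le_one_ae hρ0 Q hl x)

lemma expMom_pos {ρ : S × T → ℝ} (hρm : Measurable ρ) (hρ0 : ∀ z, 0 ≤ ρ z)
    (Q : Measure T) [IsProbabilityMeasure Q] {l : ℝ} (hl : 0 ≤ l) (x : S) :
    0 < expMom ρ Q l x :=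
  integral_exp_pos (integrable_sec hρm hρ0 Q hl x)

lemma expMom_le_one {ρ : S × T → ℝ} (hρm : Measurable ρ) (hρ0 : ∀ z, 0 ≤ ρ z)
    (Q : Measure T) [IsProbabilityMeasure Q] {l : ℝ} (hl : 0 ≤ l) (x : S) :
    expMom ρ Q l x ≤ 1 := by
  have := integral_mono_ae (integrable_sec hρm hρ0 Q hl x) (integrable_const (1 : ℝ))
    ((exp_le_one_ae hρ0 Q hl x).mono fun y hy => (le_abs_self _).trans hy)
  simpa [expMom] using this

lemma measurableSet_optSet {ρ : S × T → ℝ} (hρm : Measurable ρ) (hρ0 : ∀ z, 0 ≤ ρ z)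
    (Q : Measure T) [IsProbabilityMeasure Q] : MeasurableSet (optSet ρ Q) :=
  measurableSet_eq_fun hρm ((measurable_rhoQ hρm hρ0 Q).comp measurable_fst)

lemma le_expMom {ρ : S × T → ℝ} (hρm : Measurable ρ) (hρ0 : ∀ z, 0 ≤ ρ z)
    (Q : Measure T) [IsProbabilityMeasure Q] {l : ℝ} (hl : 0 ≤ l) (x : S) :
    (Q (Prod.mk x ⁻¹' optSet ρ Q)).toReal ≤ expMom ρ Q l x := by
  have hms : MeasurableSet (Prod.mk x ⁻¹' optSet ρ Q) :=
    measurable_prodMk_left (measurableSet_optSet hρm hρ0 Q)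
  have h1 : (Q (Prod.mk x ⁻¹' optSet ρ Q)).toReal
      = ∫ y, (Prod.mk x ⁻¹' optSet ρ Q).indicator (fun _ => (1 : ℝ)) y ∂Q := by
    rw [integral_indicator_const _ hms]
    simp [Measure.real]
  rw [h1]
  refine integral_mono ((integrable_const 1).indicator hms) (integrable_sec hρm hρ0 Q hl x) ?_
  intro y
  by_cases hy : y ∈ Prod.mk x ⁻¹' optSet ρ Q
  · have : ρ (x, y) = rhoQ ρ Q x := hy
    simp [hy, this]
  · simp [hy, (Real.exp_pos _).le]

lemma tendsto_expMom {ρ : S × T → ℝ} (hρm : Measurable ρ) (hρ0 : ∀ z, 0 ≤ ρ z)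
    (Q : Measure T) [IsProbabilityMeasure Q] (x : S) :
    Tendsto (fun j : ℕ => expMom ρ Q j x) atTop (𝓝 (Q (Prod.mk x ⁻¹' optSet ρ Q)).toReal) := by
  have hms : MeasurableSet (Prod.mk x ⁻¹' optSet ρ Q) :=
    measurable_prodMk_left (measurableSet_optSet hρm hρ0 Q)
  have h1 : (Q (Prod.mk x ⁻¹' optSet ρ Q)).toReal
      = ∫ y, (Prod.mk x ⁻¹' optSet ρ Q).indicator (fun _ => (1 : ℝ)) y ∂Q := by
    rw [integral_indicator_const _ hms]
    simp [Measure.real]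
  rw [h1]
  refine tendsto_integral_of_dominated_convergence (fun _ => 1)
    (fun j => (meas_sec hρm Q j x).aestronglyMeasurable) (integrable_const 1)
    (fun j => exp_le_one_ae hρ0 Q (Nat.cast_nonneg j) x) ?_
  filter_upwards [rhoQ_le_ae hρ0 Q x] with y hy
  by_cases hy' : y ∈ Prod.mk x ⁻¹' optSet ρ Q
  · have : ρ (x, y) = rhoQ ρ Q x := hy'
    simp [hy', this]
  · have hne : ρ (x, y) ≠ rhoQ ρ Q x := hy'
    have hlt : 0 < ρ (x, y) - rhoQ ρ Q x := sub_pos.2 (lt_of_le_of_ne hy (Ne.symm hne))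
    rw [indicator_of_notMem hy']
    exact Real.tendsto_exp_neg_atTop_nhds_zero.comp
      (tendsto_natCast_atTop_atTop.atTop_mul_const hlt)

lemma measurable_expMom {ρ : S × T → ℝ} (hρm : Measurable ρ) (hρ0 : ∀ z, 0 ≤ ρ z)
    (Q : Measure T) [IsProbabilityMeasure Q] (l : ℝ) : Measurable (expMom ρ Q l) := by
  have hrm := measurable_rhoQ hρm hρ0 Q
  have h : Measurable fun z : S × T => Real.exp (-(l * (ρ z - rhoQ ρ Q z.1))) := by fun_prop
  exact (StronglyMeasurable.integral_prod_right' h.stronglyMeasurable).measurable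

lemma chernoff {ρ : S × T → ℝ} (hρm : Measurable ρ) (hρ0 : ∀ z, 0 ≤ ρ z)
    (Q : Measure T) [IsProbabilityMeasure Q] {l : ℝ} (hl : 0 ≤ l) {D : ℝ} {n : ℕ}
    (hn : 0 < n) (x : ℕ → S) :
    Real.exp (-(l * (n * D - ∑ k ∈ Finset.range n, rhoQ ρ Q (x k)))) * (ballMass ρ Q D n x).toReal
      ≤ ∏ k ∈ Finset.range n, expMom ρ Q l (x k) := by
  set F : (Fin n → T) → ℝ := fun y =>
    ∏ k : Fin n, Real.exp (-(l * (ρ (x k, y k) - rhoQ ρ Q (x k)))) with hF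
  have hFi : Integrable F (Measure.pi fun _ : Fin n => Q) :=
    Integrable.fintype_prod (f := fun (k : Fin n) (t : T) =>
      Real.exp (-(l * (ρ (x k, t) - rhoQ ρ Q (x k))))) fun k => integrable_sec hρm hρ0 Q hl (x k)
  have hFe : ∫ y, F y ∂(Measure.pi fun _ : Fin n => Q)
      = ∏ k ∈ Finset.range n, expMom ρ Q l (x k) := by
    rw [Finset.prod_range (f := fun k => expMom ρ Q l (x k))]
    exact integral_fintype_prod_eq_prod (fun (k : Fin n) (t : T) =>
      Real.exp (-(l * (ρ (x k, t) - rhoQ ρ Q (x k)))))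
  rw [← hFe]
  set ε := Real.exp (-(l * (n * D - ∑ k ∈ Finset.range n, rhoQ ρ Q (x k)))) with hε
  refine le_trans ?_ (mul_meas_ge_le_integral_of_nonneg
    (ae_of_all _ fun y => Finset.prod_nonneg fun k _ => (Real.exp_pos _).le) hFi ε)
  refine mul_le_mul_of_nonneg_left ?_ (Real.exp_pos _).le
  refine ENNReal.toReal_mono (measure_ne_top _ _) (measure_mono ?_)
  intro y hy
  rw [mem_setOf_eq, mem_ball_iff hn] at hy
  rw [mem_setOf_eq, hε]
  rw [← Real.exp_sum, Real.exp_le_exp, Finset.sum_neg_distrib, neg_le_neg_iff, ← Finset.mul_sum,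
    Finset.sum_sub_distrib, Finset.sum_range (f := fun k => rhoQ ρ Q (x k))]
  exact mul_le_mul_of_nonneg_left (by linarith) hl

/-- Lower cost functions. -/
def lowCost (ρ : S × T → ℝ) (Q : Measure T) (l : ℝ) (x : S) : ℝ := -Real.log (expMom ρ Q l x)

lemma lowCost_bounds {ρ : S × T → ℝ} (hρm : Measurable ρ) (hρ0 : ∀ z, 0 ≤ ρ z)
    (Q : Measure T) [IsProbabilityMeasure Q] {l : ℝ} (hl : 0 ≤ l) (x : S)
    (hx : Q (Prod.mk x ⁻¹' optSet ρ Q) ≠ 0) :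
    ‖lowCost ρ Q l x‖ ≤ optCost ρ Q x := by
  have h0 := Real.log_nonpos (expMom_pos hρm hρ0 Q hl x).le (expMom_le_one hρm hρ0 Q hl x)
  have h1 := Real.log_le_log (ENNReal.toReal_pos hx (measure_ne_top _ _))
    (le_expMom hρm hρ0 Q hl x)
  unfold lowCost optCost
  rw [Real.norm_eq_abs, abs_of_nonneg (by linarith)]
  linarith

lemma measurable_lowCost {ρ : S × T → ℝ} (hρm : Measurable ρ) (hρ0 : ∀ z, 0 ≤ ρ z)
    (Q : Measure T) [IsProbabilityMeasure Q] (l : ℝ) : Measurable (lowCost ρ Q l) :=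
  (Real.measurable_log.comp (measurable_expMom hρm hρ0 Q l)).neg

lemma measurable_optCost {ρ : S × T → ℝ} (hρm : Measurable ρ) (hρ0 : ∀ z, 0 ≤ ρ z)
    (Q : Measure T) [IsProbabilityMeasure Q] : Measurable (optCost ρ Q) :=
  (Real.measurable_log.comp (measurable_measure_prodMk_left
    (measurableSet_optSet hρm hρ0 Q)).ennreal_toReal).neg

lemma integral_lowCost_tendsto {ρ : S × T → ℝ} (hρm : Measurable ρ) (hρ0 : ∀ z, 0 ≤ ρ z)
    {P : Measure S} {Q : Measure T} [IsProbabilityMeasure Q]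
    (hq : ∀ᵐ x ∂P, Q (Prod.mk x ⁻¹' optSet ρ Q) ≠ 0) (hi : Integrable (optCost ρ Q) P) :
    (∀ j : ℕ, Integrable (lowCost ρ Q j) P) ∧
    Tendsto (fun j : ℕ => ∫ x, lowCost ρ Q j x ∂P) atTop (𝓝 (∫ x, optCost ρ Q x ∂P)) := by
  have hb : ∀ j : ℕ, ∀ᵐ x ∂P, ‖lowCost ρ Q j x‖ ≤ optCost ρ Q x := fun j =>
    hq.mono fun x hx => lowCost_bounds hρm hρ0 Q (Nat.cast_nonneg j) x hx
  refine ⟨fun j => Integrable.mono' hi (measurable_lowCost hρm hρ0 Q j).aestronglyMeasurable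
    (hb j), ?_⟩
  refine tendsto_integral_of_dominated_convergence _
    (fun j => (measurable_lowCost hρm hρ0 Q j).aestronglyMeasurable) hi hb ?_
  filter_upwards [hq] with x hx
  exact ((tendsto_expMom hρm hρ0 Q x).log
    (ENNReal.toReal_pos hx (measure_ne_top _ _)).ne').neg

lemma upper_bound {ρ : S × T → ℝ} {Q : Measure T} [IsProbabilityMeasure Q] {D : ℝ} {n : ℕ}
    (hn : 0 < n) (x : ℕ → S) (h : ∑ k ∈ Finset.range n, rhoQ ρ Q (x k) ≤ n * D)
    (hx : ∀ k, Q (Prod.mk (x k) ⁻¹' optSet ρ Q) ≠ 0) :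
    ballMass ρ Q D n x ≠ 0 ∧
    -Real.log (ballMass ρ Q D n x).toReal ≤ ∑ k ∈ Finset.range n, optCost ρ Q (x k) := by
  have hle := prod_le_ballMass hn x h
  have hp : ∏ k ∈ Finset.range n, Q (Prod.mk (x k) ⁻¹' optSet ρ Q) ≠ 0 :=
    Finset.prod_ne_zero_iff.2 fun k _ => hx k
  have hb : ballMass ρ Q D n x ≠ 0 := fun h0 => hp (le_antisymm (h0 ▸ hle) bot_le)
  refine ⟨hb, ?_⟩
  have h1 := ENNReal.toReal_mono (measure_ne_top _ _) hle
  rw [ENNReal.toReal_prod] at h1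
  have h2 : ∀ k, 0 < (Q (Prod.mk (x k) ⁻¹' optSet ρ Q)).toReal := fun k =>
    ENNReal.toReal_pos (hx k) (measure_ne_top _ _)
  have h3 := Real.log_le_log (Finset.prod_pos fun k _ => h2 k) h1
  rw [Real.log_prod (fun k _ => (h2 k).ne')] at h3
  simp only [optCost, Finset.sum_neg_distrib]
  exact neg_le_neg h3

lemma lower_bound {ρ : S × T → ℝ} (hρm : Measurable ρ) (hρ0 : ∀ z, 0 ≤ ρ z)
    (Q : Measure T) [IsProbabilityMeasure Q] {l : ℝ} (hl : 0 ≤ l) {D : ℝ} {n : ℕ}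
    (hn : 0 < n) (x : ℕ → S) (hb : ballMass ρ Q D n x ≠ 0) :
    ∑ k ∈ Finset.range n, lowCost ρ Q l (x k)
      + l * (∑ k ∈ Finset.range n, rhoQ ρ Q (x k) - n * D)
      ≤ -Real.log (ballMass ρ Q D n x).toReal := by
  have hc := chernoff hρm hρ0 Q hl (D := D) hn x
  have hbp : 0 < (ballMass ρ Q D n x).toReal := ENNReal.toReal_pos hb (measure_ne_top _ _)
  have h3 := Real.log_le_log (mul_pos (Real.exp_pos _) hbp) hc
  rw [Real.log_prod (fun k _ => (expMom_pos hρm hρ0 Q hl (x k)).ne'),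
    Real.log_mul (Real.exp_pos _).ne' hbp.ne', Real.log_exp] at h3
  simp only [lowCost, Finset.sum_neg_distrib]
  linarith

lemma birkhoffSum_shift (f : S → ℝ) (n : ℕ) (x : ℕ → S) :
    birkhoffSum shiftSeq (fun x : ℕ → S => f (x 0)) n x = ∑ k ∈ Finset.range n, f (x k) := by
  have h : ∀ (k : ℕ) (x : ℕ → S) (m : ℕ), (shiftSeq^[k] x) m = x (m + k) := by
    intro k
    induction k with
    | zero => intro x m; rfl
    | succ k ih =>
      intro x m
      rw [Function.iterate_succ_apply, ih]
      simp only [shiftSeq]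
      congr 1
  unfold birkhoffSum
  refine Finset.sum_congr rfl fun k _ => ?_
  change f ((shiftSeq^[k] x) 0) = f (x k)
  rw [h, zero_add]

lemma ae_all_coord {P : Measure S} {Psrc : Measure (ℕ → S)} [IsProbabilityMeasure Psrc]
    (hErg : Ergodic shiftSeq Psrc) (hP1 : Psrc.map (fun x => x 0) = P) {p : S → Prop}
    (h : ∀ᵐ s ∂P, p s) : ∀ᵐ x ∂Psrc, ∀ k, p (x k) := by
  rw [← hP1] at h
  have h1 : ∀ᵐ x ∂Psrc, p (x 0) := ae_of_ae_map (measurable_pi_apply 0).aemeasurable h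
  have h2 := ae_iterate hErg.toMeasurePreserving h1
  have e : ∀ (k : ℕ) (x : ℕ → S) (m : ℕ), (shiftSeq^[k] x) m = x (m + k) := by
    intro k
    induction k with
    | zero => intro x m; rfl
    | succ k ih =>
      intro x m
      rw [Function.iterate_succ_apply, ih]
      simp only [shiftSeq]
      congr 1
  filter_upwards [h2] with x hx k
  have := hx k
  rwa [e, zero_add] at this

lemma integrable_coord {P : Measure S} {Psrc : Measure (ℕ → S)}
    (hP1 : Psrc.map (fun x => x 0) = P) {f : S → ℝ} (hf : Integrable f P) :
    Integrable (fun x : ℕ → S => f (x 0)) Psrc := by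
  rw [← hP1] at hf
  exact hf.comp_measurable (measurable_pi_apply 0)

lemma integral_coord {P : Measure S} {Psrc : Measure (ℕ → S)}
    (hP1 : Psrc.map (fun x => x 0) = P) {f : S → ℝ} (hfm : Measurable f) :
    ∫ x, f (x 0) ∂Psrc = ∫ s, f s ∂P := by
  rw [← hP1, integral_map (measurable_pi_apply 0).aemeasurable hfm.aestronglyMeasurable]

lemma slln {P : Measure S} {Psrc : Measure (ℕ → S)} [IsProbabilityMeasure Psrc]
    (hErg : Ergodic shiftSeq Psrc) (hP1 : Psrc.map (fun x => x 0) = P) {f : S → ℝ}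
    (hfm : Measurable f) (hf : Integrable f P) :
    ∀ᵐ x ∂Psrc, Tendsto (fun n : ℕ => (n : ℝ)⁻¹ * ∑ k ∈ Finset.range n, f (x k)) atTop
      (𝓝 (∫ s, f s ∂P)) := by
  have h := birkhoff_ergodic hErg (hfm.comp (measurable_pi_apply 0)) (integrable_coord hP1 hf)
  filter_upwards [h] with x hx
  have e := integral_coord hP1 hfm
  simp only [Function.comp_def] at hx
  rw [e] at hx
  refine hx.congr fun n => ?_
  rw [birkhoffSum_shift]

end InfoPart

/-- in the pathological situation `0 < D = D_min(P,Q) < ∞`,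
`R(P,Q,D) < ∞`, `ρ_Q(X_1)` not a.s. constant: (i) with positive probability
`L_n = ∞` infinitely often; (ii) almost surely `L_n < ∞` infinitely often;
(iii) almost surely, along the subsequence of indices where `L_n` is finite,
`L_n → R(P,Q,D)`; and that subsequence coincides a.s. with the set of indices `n`
such that `∑_{k=1}^n ρ_Q(X_k) ≤ nD`. -/
theorem stmt11 {S T : Type*} [MeasurableSpace S] [StandardBorelSpace S]
    [MeasurableSpace T] [StandardBorelSpace T]
    (ρ : S × T → ℝ) (hρm : Measurable ρ) (hρ0 : ∀ z, 0 ≤ ρ z)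
    (P : Measure S) (Q : Measure T) [IsProbabilityMeasure P] [IsProbabilityMeasure Q]
    (Psrc : Measure (ℕ → S)) [IsProbabilityMeasure Psrc]
    (hErg : Ergodic shiftSeq Psrc)
    (hP1 : Psrc.map (fun x => x 0) = P) (D : ℝ)
    (hD0 : 0 < D)
    (hDmin : D = sInf {D' : ℝ | Rrate ρ P Q D' ≠ ⊤})
    (hRfin : Rrate ρ P Q D ≠ ⊤)
    (hnc : ¬ ∃ c : ℝ, ∀ᵐ s ∂P, rhoQ ρ Q s = c) :
    0 < Psrc {x | ∃ᶠ n in atTop, LnIID ρ Q D n x = ⊤} ∧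
    (∀ᵐ x ∂Psrc, ∃ᶠ n in atTop, LnIID ρ Q D n x ≠ ⊤) ∧
    (∀ᵐ x ∂Psrc, Tendsto (fun n => LnIID ρ Q D n x)
      (atTop ⊓ 𝓟 {n : ℕ | LnIID ρ Q D n x ≠ ⊤}) (𝓝 (Rrate ρ P Q D))) ∧
    (∀ᵐ x ∂Psrc, ∀ n : ℕ, LnIID ρ Q D n x ≠ ⊤ ↔
      ∑ k ∈ Finset.range n, rhoQ ρ Q (x k) ≤ n * D) := by

  obtain ⟨hri, hrint, hq, hci, hR⟩ := info_main hρm hρ0 hDmin hRfin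
  have hrm := measurable_rhoQ hρm hρ0 Q
  have hqk := ae_all_coord hErg hP1 hq
  -- the set of finite indices
  have hiff : ∀ᵐ x ∂Psrc, ∀ n : ℕ, LnIID ρ Q D n x ≠ ⊤ ↔
      ∑ k ∈ Finset.range n, rhoQ ρ Q (x k) ≤ n * D := by
    filter_upwards [hqk] with x hx n
    rcases Nat.eq_zero_or_pos n with rfl | hn
    · simpa using LnIID_zero_ne_top hD0 x
    · rw [LnIID_ne_top_iff hn]
      exact ⟨sum_le_of_ballMass hρ0 hn x, fun h => (upper_bound hn x h hx).1⟩
  have hsum : ∀ (x : ℕ → S) (n : ℕ), ∑ k ∈ Finset.range n, (rhoQ ρ Q (x k) - D)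
      = ∑ k ∈ Finset.range n, rhoQ ρ Q (x k) - n * D := by
    intro x n
    simp [Finset.sum_sub_distrib]
  refine ⟨?_, ?_, ?_, hiff⟩
  · rw [pos_iff_ne_zero]
    intro h0
    apply hnc
    refine ⟨D, ?_⟩
    have hm : Measurable fun s => D - rhoQ ρ Q s := measurable_const.sub hrm
    have hi : Integrable (fun s => D - rhoQ ρ Q s) P := (integrable_const D).sub hri
    have hint0 : ∫ x : ℕ → S, (D - rhoQ ρ Q (x 0)) ∂Psrc = 0 := by
      rw [integral_coord hP1 hm, integral_sub (integrable_const D) hri, hrint]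
      simp
    have hz := ae_zero_of_eventually_nonneg (f := fun x : ℕ → S => D - rhoQ ρ Q (x 0)) hErg
      (hm.comp (measurable_pi_apply 0)) (integrable_coord hP1 hi) hint0 (by
        have h1 : ∀ᵐ x ∂Psrc, ¬ ∃ᶠ n in atTop, LnIID ρ Q D n x = ⊤ :=
          measure_eq_zero_iff_ae_notMem.1 h0
        filter_upwards [h1, hiff] with x hx hx2
        rw [not_frequently] at hx
        filter_upwards [hx] with n hn
        have h2 := (hx2 n).1 hn
        rw [birkhoffSum_shift (fun s => D - rhoQ ρ Q s)]
        simp only [Finset.sum_sub_distrib, Finset.sum_const, Finset.card_range, nsmul_eq_mul]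
        linarith)
    have hms : MeasurableSet {s | rhoQ ρ Q s = D} := measurableSet_eq_fun hrm measurable_const
    have hev : Measurable fun x : ℕ → S => x 0 := measurable_pi_apply 0
    rw [← hP1, ae_map_iff hev.aemeasurable hms]
    filter_upwards [hz] with x hx
    linarith
  · have hm : Measurable fun s => rhoQ ρ Q s - D := hrm.sub_const D
    have hi : Integrable (fun s => rhoQ ρ Q s - D) P := hri.sub (integrable_const D)
    have hint0 : ∫ x : ℕ → S, (rhoQ ρ Q (x 0) - D) ∂Psrc = 0 := by
      rw [integral_coord hP1 hm, integral_sub hri (integrable_const D), hrint]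
      simp
    have hz := frequently_nonpos (f := fun x : ℕ → S => rhoQ ρ Q (x 0) - D) hErg
      (hm.comp (measurable_pi_apply 0)) (integrable_coord hP1 hi) hint0
    filter_upwards [hz, hiff] with x hx hx2
    refine hx.mono fun n hn => ?_
    rw [birkhoffSum_shift (fun s => rhoQ ρ Q s - D), hsum] at hn
    exact (hx2 n).2 (by linarith)
  · obtain ⟨hli, hlt⟩ := integral_lowCost_tendsto hρm hρ0 hq hci
    have s1 := slln hErg hP1 (measurable_optCost hρm hρ0 Q) hci
    have s2 := slln hErg hP1 hrm hri
    have s3 : ∀ᵐ x ∂Psrc, ∀ j : ℕ, Tendsto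
        (fun n : ℕ => (n : ℝ)⁻¹ * ∑ k ∈ Finset.range n, lowCost ρ Q j (x k)) atTop
        (𝓝 (∫ s, lowCost ρ Q j s ∂P)) :=
      ae_all_iff.2 fun j => slln hErg hP1 (measurable_lowCost hρm hρ0 Q j) (hli j)
    filter_upwards [s1, s2, s3, hqk, hiff] with x h1 h2 h3 hx hx2
    rw [hrint] at h2
    rw [hR]
    set F : Filter ℕ := atTop ⊓ 𝓟 {n : ℕ | LnIID ρ Q D n x ≠ ⊤} with hF
    have hFle : F ≤ atTop := inf_le_left
    have hFmem : ∀ᶠ n in F, 0 < n ∧ LnIID ρ Q D n x ≠ ⊤ :=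
      Filter.Eventually.and (hFle (eventually_gt_atTop 0))
        (mem_inf_of_right (mem_principal_self _))
    have hreal : Tendsto (fun n : ℕ => (n : ℝ)⁻¹ * -Real.log (ballMass ρ Q D n x).toReal) F
        (𝓝 (∫ s, optCost ρ Q s ∂P)) := by
      rw [tendsto_order]
      constructor
      · intro a ha
        obtain ⟨j, hj⟩ := (hlt.eventually (lt_mem_nhds ha)).exists
        have h4 : Tendsto (fun n : ℕ =>
            (n : ℝ)⁻¹ * ∑ k ∈ Finset.range n, lowCost ρ Q j (x k)
              + j * ((n : ℝ)⁻¹ * ∑ k ∈ Finset.range n, rhoQ ρ Q (x k) - D)) atTop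
            (𝓝 (∫ s, lowCost ρ Q j s ∂P + j * (D - D))) :=
          (h3 j).add ((h2.sub_const D).const_mul _)
        rw [sub_self, mul_zero, add_zero] at h4
        filter_upwards [hFmem, hFle (h4.eventually (lt_mem_nhds hj))] with n hn hn2
        refine lt_of_lt_of_le hn2 ?_
        have hb := (LnIID_ne_top_iff hn.1 x).1 hn.2
        have hlb := lower_bound hρm hρ0 Q (Nat.cast_nonneg j) hn.1 x hb
        have hnp : (0 : ℝ) < n := by exact_mod_cast hn.1
        have := mul_le_mul_of_nonneg_left hlb (inv_pos.2 hnp).le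
        refine le_trans (le_of_eq ?_) this
        field_simp
      · intro a ha
        filter_upwards [hFmem, hFle (h1.eventually (gt_mem_nhds ha))] with n hn hn2
        refine lt_of_le_of_lt ?_ hn2
        have hub := (upper_bound hn.1 x ((hx2 n).1 hn.2) hx).2
        exact mul_le_mul_of_nonneg_left hub (by positivity)
    refine (ENNReal.tendsto_ofReal hreal).congr' ?_
    filter_upwards [hFmem] with n hn
    exact (LnIID_eq hn.1 x ((LnIID_ne_top_iff hn.1 x).1 hn.2)).symm

end
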